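/- arXiv:0711.0830 — 6 statements merged into one kernel-verified Lean document; each statement's English description precedes it below -/
import Mathlib

section
/- Fix a perfect 3×3 Hessenberg type Ω and base matrix M₀ as in the context, with integer family H(m,n) ⊂ SL(3,ℤ). Let d ∈ ℤ² be nonzero and (m₀,n₀) ∈ ℤ² be such that for every integer t ≥ 0 the matrix H((m₀,n₀) + t·d) is an NRS-matrix (an NRS-ray). Then there exists T such that for every integer t ≥ T, every reduced perfect Hessenberg matrix that is integer conjugate to H((m₀,n₀) + t·d) is equal to H((m₀,n₀) + t·d); i.e., the ray contains only finitely many reduced matrices integer conjugate to some other reduced matrix. -/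
open Matrix Polynomial

/-- An n×n integer matrix is (upper) Hessenberg if `M i j = 0` whenever `i > j+1`
(0-based indices). -/
def IsHessenberg {n : ℕ} (M : Matrix (Fin n) (Fin n) ℤ) : Prop :=
  ∀ i j : Fin n, (j : ℕ) + 1 < (i : ℕ) → M i j = 0

/-- The subdiagonal entry `M (j+1) j` (0-based `j`), or `0` if out of range. -/
def subdiag {n : ℕ} (M : Matrix (Fin n) (Fin n) ℤ) (j : ℕ) : ℤ :=
  if h : j + 1 < n then M ⟨j + 1, h⟩ ⟨j, Nat.lt_of_succ_lt h⟩ else 0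

/-- Hessenberg complexity `ς(M) = ∏_{j=1}^{n-1} |M (j+1) j|^(n-j)` (1-based). -/
def hessComplexity {n : ℕ} (M : Matrix (Fin n) (Fin n) ℤ) : ℤ :=
  ∏ j ∈ Finset.range (n - 1), |subdiag M j| ^ (n - 1 - j)

/-- Integer conjugacy: `X * A * X⁻¹ = B` for some `X ∈ GL(n, ℤ)`. -/
def IntegerConjugate {n : ℕ} (A B : Matrix (Fin n) (Fin n) ℤ) : Prop :=
  ∃ X : Matrix (Fin n) (Fin n) ℤ, IsUnit X.det ∧ X * A = B * X

/-- Perfect Hessenberg matrix: in `SL(n,ℤ)`, Hessenberg, irreducible characteristic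
polynomial over ℚ, and `0 ≤ M i j < M (j+1) j` for `1 ≤ i ≤ j ≤ n-1` (1-based). -/
def IsPerfect {n : ℕ} (M : Matrix (Fin n) (Fin n) ℤ) : Prop :=
  M.det = 1 ∧ IsHessenberg M ∧
  Irreducible ((M.charpoly).map (Int.castRingHom ℚ)) ∧
  ∀ i j : Fin n, i ≤ j → (j : ℕ) + 1 < n → 0 ≤ M i j ∧ M i j < subdiag M (j : ℕ)

/-- A perfect Hessenberg matrix is reduced if its Hessenberg complexity is minimal
among all perfect Hessenberg matrices integer conjugate to it. -/
def IsReducedHess {n : ℕ} (W : Matrix (Fin n) (Fin n) ℤ) : Prop :=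
  IsPerfect W ∧ ∀ M : Matrix (Fin n) (Fin n) ℤ, IsPerfect M → IntegerConjugate W M →
    hessComplexity W ≤ hessComplexity M

/-- Discriminant of the monic cubic `t³ + p t² + q t + r` (integer coefficients). -/
def cubicDiscZ (p q r : ℤ) : ℤ :=
  18 * p * q * r - 4 * p ^ 3 * r + p ^ 2 * q ^ 2 - 4 * q ^ 3 - 27 * r ^ 2

/-- Discriminant of the characteristic polynomial of an integer 3×3 matrix. -/
def matDiscZ (M : Matrix (Fin 3) (Fin 3) ℤ) : ℤ :=
  cubicDiscZ (-(M 0 0 + M 1 1 + M 2 2))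
    ((M 0 0 * M 1 1 - M 0 1 * M 1 0) + (M 0 0 * M 2 2 - M 0 2 * M 2 0) +
      (M 1 1 * M 2 2 - M 1 2 * M 2 1))
    (-M.det)

/-- NRS-matrix: irreducible characteristic polynomial over ℚ with one real root and two
complex-conjugate roots (equivalently, negative discriminant). -/
def IsNRS (M : Matrix (Fin 3) (Fin 3) ℤ) : Prop :=
  Irreducible ((M.charpoly).map (Int.castRingHom ℚ)) ∧ matDiscZ M < 0

/-- The integer family `H(m,n)` of matrices of Hessenberg type
`⟨a₁₁,a₂₁|a₁₂,a₂₂,a₃₂⟩` with base third column `(a₁₃,a₂₃,a₃₃)`. -/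
def HfamZ (a11 a21 a12 a22 a32 a13 a23 a33 : ℤ) (m n : ℤ) : Matrix (Fin 3) (Fin 3) ℤ :=
  !![a11, a12, a13 + a11 * m + a12 * n;
     a21, a22, a23 + a21 * m + a22 * n;
     0,   a32, a33 + a32 * n]

theorem adjugate_eq_sq_sub {R : Type*} [CommRing R] (A : Matrix (Fin 3) (Fin 3) R) :
    A.adjugate = A * A - A.trace • A + A.adjugate.trace • 1 := by
  ext i j
  fin_cases i <;> fin_cases j <;>
    simp [Matrix.adjugate_fin_three, Matrix.mul_apply, Fin.sum_univ_three, Matrix.trace] <;> ring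

theorem det_smul_adjugate_add {R : Type*} [CommRing R] (A : Matrix (Fin 3) (Fin 3) R)
    (w x y : R) (hA : A.det = 1) :
    (w • A.adjugate + x • (1 : Matrix (Fin 3) (Fin 3) R) + y • A).det =
      w ^ 3 + x ^ 3 + y ^ 3 + w ^ 2 * x * A.trace + w * x ^ 2 * A.adjugate.trace
        + w ^ 2 * y * (A.trace ^ 2 - 2 * A.adjugate.trace)
        + w * y ^ 2 * (A.adjugate.trace ^ 2 - 2 * A.trace)
        + x ^ 2 * y * A.trace + x * y ^ 2 * A.adjugate.trace
        + w * x * y * (A.trace * A.adjugate.trace - 3) := by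
  have homogeneous : (w • A.adjugate + x • (1 : Matrix (Fin 3) (Fin 3) R) + y • A).det =
      w ^ 3 * A.det ^ 2 + x ^ 3 + y ^ 3 * A.det + w ^ 2 * x * A.trace * A.det
        + w * x ^ 2 * A.adjugate.trace
        + w ^ 2 * y * (A.trace ^ 2 - 2 * A.adjugate.trace) * A.det
        + w * y ^ 2 * (A.adjugate.trace ^ 2 - 2 * A.trace * A.det)
        + x ^ 2 * y * A.trace + x * y ^ 2 * A.adjugate.trace
        + w * x * y * (A.trace * A.adjugate.trace - 3 * A.det) := by
    simp [Matrix.adjugate_fin_three, Matrix.det_fin_three, Matrix.trace, Fin.sum_univ_three]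
    ring
  rw [homogeneous, hA]
  ring

/-- The unit of the matrix ring given by a matrix of determinant one. -/
def unitOfDetOne (A : Matrix (Fin 3) (Fin 3) ℤ) (hA : A.det = 1) :
    (Matrix (Fin 3) (Fin 3) ℤ)ˣ where
  val := A
  inv := A.adjugate
  val_inv := by rw [Matrix.mul_adjugate, hA, one_smul]
  inv_val := by rw [Matrix.adjugate_mul, hA, one_smul]

theorem adjugate_adjugate_of_det_one (A : Matrix (Fin 3) (Fin 3) ℤ) (hA : A.det = 1) :
    A.adjugate.adjugate = A := by
  rw [Matrix.adjugate_adjugate A (by simp), hA]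
  simp

theorem exists_coeffs_mul_zpow (A : Matrix (Fin 3) (Fin 3) ℤ) (hA : A.det = 1) (l : ℝ)
    (hl : 0 < l) (root : l ^ 3 = A.trace * l ^ 2 - A.adjugate.trace * l + 1) (w x y : ℤ) (k : ℤ) :
    ∃ w' x' y' : ℤ,
      (w • A.adjugate + x • (1 : Matrix (Fin 3) (Fin 3) ℤ) + y • A) *
          ((unitOfDetOne A hA ^ k : (Matrix (Fin 3) (Fin 3) ℤ)ˣ) : Matrix (Fin 3) (Fin 3) ℤ) =
        w' • A.adjugate + x' • (1 : Matrix (Fin 3) (Fin 3) ℤ) + y' • A ∧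
      (w' / l + x' + y' * l : ℝ) = l ^ k * (w / l + x + y * l) := by
  have hAadj : A * A.adjugate = 1 := by rw [Matrix.mul_adjugate, hA, one_smul]
  have hadjA : A.adjugate * A = 1 := by rw [Matrix.adjugate_mul, hA, one_smul]
  have hsq : A * A = A.trace • A - A.adjugate.trace • 1 + A.adjugate := by
    have h := adjugate_eq_sq_sub A
    generalize A.adjugate.trace • (1 : Matrix (Fin 3) (Fin 3) ℤ) = S at h ⊢
    rw [h]
    abel
  have hsq' : A.adjugate * A.adjugate =
      A.adjugate.trace • A.adjugate - A.trace • 1 + A := by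
    have h := adjugate_eq_sq_sub A.adjugate
    rw [adjugate_adjugate_of_det_one A hA] at h
    generalize A.trace • (1 : Matrix (Fin 3) (Fin 3) ℤ) = S at h ⊢
    generalize A.adjugate.trace • A.adjugate = U at h ⊢
    generalize A.adjugate * A.adjugate = V at h ⊢
    rw [h]
    abel
  induction k using Int.induction_on with
  | zero => exact ⟨w, x, y, by simp, by simp⟩
  | succ i ih =>
    obtain ⟨w', x', y', h, h'⟩ := ih
    refine ⟨y', w' - A.adjugate.trace * y', x' + A.trace * y', ?_, ?_⟩
    · rw [_root_.zpow_add_one, Units.val_mul, ← mul_assoc, h]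
      change _ * A = _
      simp only [add_mul, smul_mul_assoc, one_mul, hadjA, hsq]
      module
    · rw [zpow_add_one₀ hl.ne', mul_right_comm, ← h']
      push_cast
      field_simp
      linear_combination (-(y' : ℝ)) * root
  | pred i ih =>
    obtain ⟨w', x', y', h, h'⟩ := ih
    refine ⟨x' + A.adjugate.trace * w', y' - A.trace * w', w', ?_, ?_⟩
    · rw [_root_.zpow_sub_one, Units.val_mul, ← mul_assoc, h]
      change _ * A.adjugate = _
      simp only [add_mul, smul_mul_assoc, one_mul, hAadj, hsq']
      module
    · rw [zpow_sub_one₀ hl.ne', mul_right_comm, ← h']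
      push_cast
      field_simp
      linear_combination (w' : ℝ) * root

theorem exists_real_root (s τ : ℝ) (hτ : |s| + 2 ≤ τ) :
    ∃ l : ℝ, τ - 1 ≤ l ∧ l ^ 3 = τ * l ^ 2 - s * l + 1 := by
  have h1 := le_abs_self s
  have h2 := neg_abs_le s
  have h0 := abs_nonneg s
  have hcont : ContinuousOn (fun z : ℝ => z ^ 3 - τ * z ^ 2 + s * z - 1)
      (Set.Icc (τ - 1) (τ + 1)) := by fun_prop
  have hmem : (0 : ℝ) ∈ Set.Icc ((τ - 1) ^ 3 - τ * (τ - 1) ^ 2 + s * (τ - 1) - 1)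
      ((τ + 1) ^ 3 - τ * (τ + 1) ^ 2 + s * (τ + 1) - 1) := by
    constructor
    · have : 0 ≤ (τ - 1) * (τ - 1 - s) := mul_nonneg (by linarith) (by linarith)
      nlinarith
    · have : 1 * 1 ≤ (τ + 1) * (τ + 1 + s) :=
        mul_le_mul (by linarith) (by linarith) (by norm_num) (by linarith)
      nlinarith
  obtain ⟨l, hl, hroot⟩ := intermediate_value_Icc (by linarith) hcont hmem
  refine ⟨l, hl.1, ?_⟩
  simp only at hroot
  linarith

theorem norm_form_eq_mul (s τ l w x y : ℝ) (hl : 0 < l)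
    (root : l ^ 3 = τ * l ^ 2 - s * l + 1) :
    w ^ 3 + x ^ 3 + y ^ 3 + w ^ 2 * x * τ + w * x ^ 2 * s + w ^ 2 * y * (τ ^ 2 - 2 * s)
        + w * y ^ 2 * (s ^ 2 - 2 * τ) + x ^ 2 * y * τ + x * y ^ 2 * s + w * x * y * (τ * s - 3) =
      (w / l + x + y * l) * ((x + (y / l + w) * ((s - 1 / l) / 2)) ^ 2
        + (1 - (s - 1 / l) ^ 2 / (4 * l)) / l * (y - w * l) ^ 2) := by
  have hτ : τ = l + s / l - 1 / l ^ 2 := by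
    field_simp
    linarith
  subst hτ
  field_simp
  ring

theorem coeff_bounds_of_norm_le (s D l w x y : ℝ) (hD : 1 ≤ D)
    (hl : 512 * D ^ 2 + 16 * (|s| + 1) ^ 2 ≤ l)
    (hlow : 1 / 2 ≤ |w / l + x + y * l|)
    (hN : |w / l + x + y * l| * ((x + (y / l + w) * ((s - 1 / l) / 2)) ^ 2
        + (1 - (s - 1 / l) ^ 2 / (4 * l)) / l * (y - w * l) ^ 2) ≤ D ^ 2 / 2) :
    |y - w * l| ≤ l / 16 ∧ |x| ≤ D + (1 / 16 + 2 * |w|) * (|s| + 1) := by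
  have hs := abs_nonneg s
  have hDD : D ≤ D ^ 2 := by nlinarith
  have hl0 : 512 ≤ l := by linarith [sq_nonneg (|s| + 1)]
  have hlpos : 0 < l := by linarith
  have hinv : 1 / l ≤ 1 := by rw [div_le_one hlpos]; linarith
  have hinv0 : 0 < 1 / l := by positivity
  set S := |s| + 1 with hS
  have hS1 : 1 ≤ S := by linarith
  have hSS : S ≤ S ^ 2 := by nlinarith
  have hh : |(s - 1 / l)| ≤ S := by
    have := abs_sub s (1 / l)
    rw [abs_of_pos hinv0] at this
    linarith
  have hh2 : |(s - 1 / l) / 2| ≤ S := by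
    rw [abs_div, abs_of_pos (two_pos : (0 : ℝ) < 2)]
    linarith
  set h := (s - 1 / l) / 2
  have hc : 1 / 2 ≤ 1 - (s - 1 / l) ^ 2 / (4 * l) := by
    have : (s - 1 / l) ^ 2 / (4 * l) ≤ 1 / 2 := by
      rw [div_le_iff₀ (by positivity)]
      have := sq_le_sq' (neg_le_of_abs_le hh) (le_of_abs_le hh)
      nlinarith
    linarith
  set c := 1 - (s - 1 / l) ^ 2 / (4 * l)
  set β := w / l + x + y * l
  set u := y - w * l with hu
  have hcl : 1 / (2 * l) ≤ c / l := by
    rw [div_le_div_iff₀ (by positivity) hlpos]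
    nlinarith
  have hsq1 : 0 ≤ (x + (y / l + w) * h) ^ 2 := sq_nonneg _
  have hsq2 : 0 ≤ 1 / (2 * l) * u ^ 2 := by positivity
  have hsq3 : 1 / (2 * l) * u ^ 2 ≤ c / l * u ^ 2 :=
    mul_le_mul_of_nonneg_right hcl (sq_nonneg _)
  have hQ : (x + (y / l + w) * h) ^ 2 + c / l * u ^ 2 ≤ D ^ 2 := by
    have := mul_le_mul_of_nonneg_right hlow (add_nonneg hsq1 (hsq2.trans hsq3))
    linarith
  have hX : |x + (y / l + w) * h| ≤ D := abs_le_of_sq_le_sq (by linarith) (by linarith)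
  have hU : |u| ≤ l / 16 := by
    refine abs_le_of_sq_le_sq ?_ (by linarith)
    have h1 : 1 / (2 * l) * u ^ 2 ≤ D ^ 2 := by linarith
    rw [div_mul_eq_mul_div, div_le_iff₀ (by positivity)] at h1
    have : 512 * D ^ 2 * l ≤ l * l := mul_le_mul_of_nonneg_right (by nlinarith) hlpos.le
    nlinarith
  have hul : |u / l| ≤ 1 / 16 := by
    rw [abs_div, abs_of_pos hlpos, div_le_iff₀ hlpos]
    linarith
  have hyl : y / l = u / l + w := by
    rw [hu]
    field_simp
    ring
  refine ⟨hU, ?_⟩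
  have h1 : x = (x + (y / l + w) * h) - (u / l + 2 * w) * h := by rw [hyl]; ring
  have h2 : |u / l + 2 * w| ≤ 1 / 16 + 2 * |w| := by
    refine (abs_add_le _ _).trans ?_
    rw [abs_mul, abs_of_pos (two_pos : (0 : ℝ) < 2)]
    linarith
  have h3 : |(u / l + 2 * w) * h| ≤ (1 / 16 + 2 * |w|) * S := by
    rw [abs_mul]
    exact mul_le_mul h2 hh2 (abs_nonneg _) (by positivity)
  rw [h1]
  exact (abs_sub _ _).trans (add_le_add hX h3)

theorem coeffs_eq_zero_of_norm_le (s D l : ℝ) (hD : 1 ≤ D)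
    (hl : 512 * D ^ 2 + 16 * (|s| + 1) ^ 2 ≤ l) (w x y : ℤ)
    (hlow : 1 / 2 ≤ |(w / l + x + y * l : ℝ)|) (hupp : |(w / l + x + y * l : ℝ)| < l / 2)
    (hN : |(w / l + x + y * l : ℝ)| * ((x + (y / l + w) * ((s - 1 / l) / 2)) ^ 2
        + (1 - (s - 1 / l) ^ 2 / (4 * l)) / l * (y - w * l) ^ 2) ≤ D ^ 2 / 2) :
    w = 0 ∧ y = 0 := by
  have hDD : D ≤ D ^ 2 := by nlinarith
  have hl0 : 512 ≤ l := by linarith [sq_nonneg (|s| + 1)]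
  have hlpos : 0 < l := by linarith
  obtain ⟨hU, hx⟩ := coeff_bounds_of_norm_le s D l w x y hD hl hlow hN
  have hS1 : 1 ≤ |s| + 1 := by linarith [abs_nonneg s]
  set S := |s| + 1
  have hSS : S ≤ S ^ 2 := by nlinarith
  set β : ℝ := w / l + x + y * l with hβ
  set u : ℝ := y - w * l with hu
  have hlD : D ≤ l / 512 := by linarith [sq_nonneg S]
  have hlS : S ≤ l / 16 := by linarith [sq_nonneg D]
  have hw : w = 0 := by
    by_contra hw
    have hw1 : (1 : ℝ) ≤ |(w : ℝ)| := by exact_mod_cast Int.one_le_abs hw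
    have h1 : (w : ℝ) * l ^ 2 = β - w / l - x - u * l := by rw [hβ, hu]; ring
    have h2 : |(w : ℝ)| * l ^ 2 ≤ |β| + |(w : ℝ)| + |(x : ℝ)| + |u| * l := by
      have h3 : |(w : ℝ)| * l ^ 2 = |β - w / l - x - u * l| := by
        rw [← h1, abs_mul, abs_of_pos (by positivity : 0 < l ^ 2)]
      have h4 : |(w / l : ℝ)| ≤ |(w : ℝ)| := by
        rw [abs_div, abs_of_pos hlpos]
        exact div_le_self (abs_nonneg _) (by linarith)
      have h5 : |u * l| = |u| * l := by rw [abs_mul, abs_of_pos hlpos]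
      rw [h3]
      have := abs_sub (β - w / l - x) (u * l)
      have := abs_sub (β - w / l) (x : ℝ)
      have := abs_sub β (w / l : ℝ)
      linarith
    have hwl : 1 * l ≤ |(w : ℝ)| * l := mul_le_mul_of_nonneg_right hw1 hlpos.le
    have h6 : |u| * l ≤ |(w : ℝ)| * (l ^ 2 / 16) := by
      have h3 : |u| * l ≤ l / 16 * l := mul_le_mul_of_nonneg_right hU hlpos.le
      have h4 : 1 * l ^ 2 ≤ |(w : ℝ)| * l ^ 2 :=
        mul_le_mul_of_nonneg_right hw1 (sq_nonneg l)
      linarith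
    have h7 : |(x : ℝ)| ≤ |(w : ℝ)| * l := by
      have : (1 / 16 + 2 * |(w : ℝ)|) * S ≤ (3 * |(w : ℝ)|) * (l / 16) :=
        mul_le_mul (by linarith) hlS (by linarith) (by linarith)
      linarith
    have h8 : |β| ≤ |(w : ℝ)| * l := by linarith
    have h9 : |(w : ℝ)| ≤ |(w : ℝ)| * l := le_mul_of_one_le_right (abs_nonneg _) (by linarith)
    have h10 : |(w : ℝ)| * l ^ 2 ≤ |(w : ℝ)| * (3 * l + l ^ 2 / 16) := by linarith
    have h11 := le_of_mul_le_mul_left h10 (by linarith)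
    have h12 : 512 * l ≤ l * l := mul_le_mul_of_nonneg_right hl0 hlpos.le
    linarith
  refine ⟨hw, ?_⟩
  by_contra hy
  have hy1 : (1 : ℝ) ≤ |(y : ℝ)| := by exact_mod_cast Int.one_le_abs hy
  subst hw
  simp only [Int.cast_zero, abs_zero, zero_div, zero_add, mul_zero, add_zero] at hβ hx
  have h1 : |(y : ℝ)| * l = |β - x| := by
    rw [hβ, add_sub_cancel_left, abs_mul, abs_of_pos hlpos]
  have h2 := abs_sub β (x : ℝ)
  have h3 : 1 * l ≤ |(y : ℝ)| * l := mul_le_mul_of_nonneg_right hy1 hlpos.le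
  linarith

theorem exists_mul_zpow_eq_smul_one (s C : ℤ) :
    ∃ T : ℤ, ∀ (A : Matrix (Fin 3) (Fin 3) ℤ) (hA : A.det = 1), A.adjugate.trace = s →
      T ≤ A.trace → ∀ w x y : ℤ,
      (w • A.adjugate + x • (1 : Matrix (Fin 3) (Fin 3) ℤ) + y • A).det ≠ 0 →
      |(w • A.adjugate + x • (1 : Matrix (Fin 3) (Fin 3) ℤ) + y • A).det| ≤ C →
      ∃ k z : ℤ, (w • A.adjugate + x • (1 : Matrix (Fin 3) (Fin 3) ℤ) + y • A) *
        ((unitOfDetOne A hA ^ k : (Matrix (Fin 3) (Fin 3) ℤ)ˣ) : Matrix (Fin 3) (Fin 3) ℤ) =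
          z • (1 : Matrix (Fin 3) (Fin 3) ℤ) := by
  refine ⟨512 * (2 * |C| + 1) ^ 2 + 16 * (|s| + 1) ^ 2 + |s| + 2,
    fun A hA hs hT w x y hne hle => ?_⟩
  set D : ℝ := 2 * |(C : ℝ)| + 1 with hD
  have hD1 : 1 ≤ D := by linarith [abs_nonneg (C : ℝ)]
  have hT' : 512 * D ^ 2 + 16 * (|(s : ℝ)| + 1) ^ 2 + |(s : ℝ)| + 2 ≤ (A.trace : ℝ) := by
    rw [hD]
    exact_mod_cast hT
  have hS := abs_nonneg (s : ℝ)
  have hDD : 1 ≤ D ^ 2 := one_le_pow₀ hD1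
  have hSS := sq_nonneg (|(s : ℝ)| + 1)
  obtain ⟨l, hl, root⟩ := exists_real_root (s : ℝ) (A.trace : ℝ) (by linarith)
  have hl1 : 512 * D ^ 2 + 16 * (|(s : ℝ)| + 1) ^ 2 ≤ l := by linarith
  have hlpos : 0 < l := by linarith
  have root' : l ^ 3 = A.trace * l ^ 2 - A.adjugate.trace * l + 1 := by rw [hs]; exact root
  have det_eq : ∀ w x y : ℤ,
      ((w • A.adjugate + x • (1 : Matrix (Fin 3) (Fin 3) ℤ) + y • A).det : ℝ) =
      (w / l + x + y * l) * ((x + (y / l + w) * ((s - 1 / l) / 2)) ^ 2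
        + (1 - (s - 1 / l) ^ 2 / (4 * l)) / l * (y - w * l) ^ 2) := by
    intro w x y
    rw [det_smul_adjugate_add A w x y hA, hs, ← norm_form_eq_mul s A.trace l w x y hlpos root]
    push_cast
    ring
  have hβ : (w / l + x + y * l : ℝ) ≠ 0 := by
    intro h0
    have h := det_eq w x y
    rw [h0, zero_mul] at h
    exact hne (by exact_mod_cast h)
  obtain ⟨n, hn1, hn2⟩ := exists_mem_Ico_zpow
    (x := 2 * |(w / l + x + y * l : ℝ)|) (y := l) (by positivity) (by linarith)
  obtain ⟨w', x', y', hP, hβ'⟩ := exists_coeffs_mul_zpow A hA l hlpos root' w x y (-n)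
  have hdet : |(w' • A.adjugate + x' • (1 : Matrix (Fin 3) (Fin 3) ℤ) + y' • A).det| ≤ C := by
    rw [← hP, Matrix.det_mul, abs_mul]
    have hunit : IsUnit (((unitOfDetOne A hA ^ (-n) : (Matrix (Fin 3) (Fin 3) ℤ)ˣ) :
        Matrix (Fin 3) (Fin 3) ℤ)).det := (Matrix.isUnit_iff_isUnit_det _).mp (Units.isUnit _)
    rw [Int.isUnit_iff_abs_eq.mp hunit, mul_one]
    exact hle
  have habs : |(w' / l + x' + y' * l : ℝ)| = |(w / l + x + y * l : ℝ)| / l ^ n := by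
    rw [hβ', abs_mul, abs_of_pos (by positivity), _root_.zpow_neg, inv_mul_eq_div]
  have hln : 0 < l ^ n := by positivity
  have hlow : 1 / 2 ≤ |(w' / l + x' + y' * l : ℝ)| := by
    rw [habs, le_div_iff₀ hln]
    linarith
  have hupp : |(w' / l + x' + y' * l : ℝ)| < l / 2 := by
    rw [habs, div_lt_iff₀ hln]
    rw [zpow_add_one₀ hlpos.ne'] at hn2
    linarith
  have hQ : |(w' / l + x' + y' * l : ℝ)| * ((x' + (y' / l + w') * ((s - 1 / l) / 2)) ^ 2
        + (1 - (s - 1 / l) ^ 2 / (4 * l)) / l * (y' - w' * l) ^ 2) ≤ D ^ 2 / 2 := by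
    have h1 : (|(w' • A.adjugate + x' • (1 : Matrix (Fin 3) (Fin 3) ℤ) + y' • A).det| : ℝ)
        ≤ C := by exact_mod_cast hdet
    rw [det_eq, abs_mul] at h1
    have h2 := le_abs_self ((x' + (y' / l + w') * ((s - 1 / l) / 2)) ^ 2
        + (1 - (s - 1 / l) ^ 2 / (4 * l)) / l * (y' - w' * l) ^ 2 : ℝ)
    have h3 := mul_le_mul_of_nonneg_left h2 (abs_nonneg (w' / l + x' + y' * l : ℝ))
    have h4 := le_abs_self (C : ℝ)
    have h5 : 2 * |(C : ℝ)| ≤ D ^ 2 := by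
      rw [hD]
      nlinarith [abs_nonneg (C : ℝ)]
    linarith
  obtain ⟨hw, hy⟩ := coeffs_eq_zero_of_norm_le s D l hD1 hl1 w' x' y' hlow hupp hQ
  exact ⟨-n, x', by rw [hP, hw, hy]; simp⟩

theorem eq_zero_of_mul_eq_add_mul {e a b p q : ℤ} (he : IsUnit e) (ha : 0 ≤ a) (ha' : a < q)
    (hb : 0 ≤ b) (hb' : b < q) (h : a * e = e * b + p * q) : p = 0 := by
  have hlt : |p * q| < q := by
    have h1 : p * q = e * (a - b) := by linear_combination -h
    rw [h1, abs_mul, Int.isUnit_iff_abs_eq.mp he, one_mul, abs_lt]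
    constructor <;> linarith
  have hq : 0 < q := by linarith
  rw [abs_mul, abs_of_pos hq] at hlt
  by_contra hp
  nlinarith [Int.one_le_abs hp]

theorem eq_of_isUnit_of_mul_eq {e f a b : ℤ} (he : IsUnit e) (hf : IsUnit f) (ha : 0 < a)
    (hb : 0 < b) (h : a * e = f * b) : f = e := by
  rcases Int.isUnit_iff.mp he with rfl | rfl <;> rcases Int.isUnit_iff.mp hf with rfl | rfl <;>
    omega

theorem IsPerfect.bounds {M : Matrix (Fin 3) (Fin 3) ℤ} (h : IsPerfect M) :
    M 2 0 = 0 ∧ (0 ≤ M 0 0 ∧ M 0 0 < M 1 0) ∧ (0 ≤ M 0 1 ∧ M 0 1 < M 2 1) ∧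
      (0 ≤ M 1 1 ∧ M 1 1 < M 2 1) := by
  obtain ⟨-, hH, -, hb⟩ := h
  exact ⟨hH 2 0 (by simp), by simpa [subdiag] using hb 0 0 le_rfl (by simp),
    by simpa [subdiag] using hb 0 1 (by simp) (by simp),
    by simpa [subdiag] using hb 1 1 le_rfl (by simp)⟩

theorem hessComplexity_three (M : Matrix (Fin 3) (Fin 3) ℤ) :
    hessComplexity M = |M 1 0| ^ 2 * |M 2 1| := by
  simp [hessComplexity, Finset.prod_range_succ, subdiag]

theorem IsPerfect.eq_of_conj {H W Y : Matrix (Fin 3) (Fin 3) ℤ} (hH : IsPerfect H)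
    (hW : IsPerfect W) (hY : IsUnit Y.det) (hconj : H * Y = Y * W) (h1 : Y 1 0 = 0)
    (h2 : Y 2 0 = 0) : H = W := by
  obtain ⟨hH0, ⟨hH1, hH2⟩, ⟨hH3, hH4⟩, hH5, hH6⟩ := hH.bounds
  obtain ⟨hW0, ⟨hW1, hW2⟩, ⟨hW3, hW4⟩, hW5, hW6⟩ := hW.bounds
  have entry : ∀ i j, H i 0 * Y 0 j + H i 1 * Y 1 j + H i 2 * Y 2 j =
      Y i 0 * W 0 j + Y i 1 * W 1 j + Y i 2 * W 2 j := by
    intro i j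
    have := congrFun (congrFun hconj i) j
    simpa [Matrix.mul_apply, Fin.sum_univ_three] using this
  have hY21 : Y 2 1 = 0 := by
    have h := entry 2 0
    rw [h1, h2, hH0, hW0] at h
    have h' : Y 2 1 * W 1 0 = 0 := by linarith
    exact (mul_eq_zero.mp h').resolve_right (by linarith)
  have hdet : Y.det = Y 0 0 * Y 1 1 * Y 2 2 := by
    rw [Matrix.det_fin_three, h1, h2, hY21]
    ring
  rw [hdet, IsUnit.mul_iff, IsUnit.mul_iff] at hY
  obtain ⟨⟨hu0, hu1⟩, hu2⟩ := hY
  have e1 : Y 1 1 = Y 0 0 := by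
    have h := entry 1 0
    rw [h1, h2, hW0] at h
    exact eq_of_isUnit_of_mul_eq (a := H 1 0) (b := W 1 0) hu0 hu1 (by linarith) (by linarith)
      (by linarith)
  have q1 : H 1 0 = W 1 0 := by
    have h := entry 1 0
    rw [h1, h2, hW0, e1] at h
    exact mul_left_cancel₀ hu0.ne_zero (by linarith)
  have hY01 : Y 0 1 = 0 := by
    have h := entry 0 0
    rw [h1, h2, hW0] at h
    exact eq_zero_of_mul_eq_add_mul (a := H 0 0) (b := W 0 0) (q := W 1 0) hu0 hH1
      (by linarith) hW1 hW2 (by linarith)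
  have e2 : Y 2 2 = Y 0 0 := by
    have h := entry 2 1
    rw [h2, hY21, hH0, e1] at h
    exact eq_of_isUnit_of_mul_eq (a := H 2 1) (b := W 2 1) hu0 hu2 (by linarith) (by linarith)
      (by linarith)
  have q2 : H 2 1 = W 2 1 := by
    have h := entry 2 1
    rw [h2, hY21, hH0, e1, e2] at h
    exact mul_left_cancel₀ hu0.ne_zero (by linarith)
  have hY12 : Y 1 2 = 0 := by
    have h := entry 1 1
    rw [hY21, hY01, h1, e1] at h
    exact eq_zero_of_mul_eq_add_mul (a := H 1 1) (b := W 1 1) (q := W 2 1) hu0 hH5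
      (by linarith) hW5 hW6 (by linarith)
  have hY02 : Y 0 2 = 0 := by
    have h := entry 0 1
    rw [hY21, hY01, e1] at h
    exact eq_zero_of_mul_eq_add_mul (a := H 0 1) (b := W 0 1) (q := W 2 1) hu0 hH3
      (by linarith) hW3 hW4 (by linarith)
  have hYs : Y = Y 0 0 • (1 : Matrix (Fin 3) (Fin 3) ℤ) := by
    ext i j
    fin_cases i <;> fin_cases j <;> simp [*]
  rw [hYs, Matrix.mul_smul, Matrix.smul_mul, mul_one, one_mul] at hconj
  exact smul_right_injective _ hu0.ne_zero hconj

theorem IsPerfect.eq_of_mul_unit_eq_smul {H W Y P : Matrix (Fin 3) (Fin 3) ℤ}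
    (hH : IsPerfect H) (hW : IsPerfect W) (hY : IsUnit Y.det) (hconj : H * Y = Y * W)
    {c z : ℤ} (hc : c ≠ 0) (hP : ∀ i, P i 0 = c * Y i 0) (U : (Matrix (Fin 3) (Fin 3) ℤ)ˣ)
    (hU : Commute H U) (hPU : P * U = z • (1 : Matrix (Fin 3) (Fin 3) ℤ)) : H = W := by
  have hUP : (U : Matrix (Fin 3) (Fin 3) ℤ) * P = z • (1 : Matrix (Fin 3) (Fin 3) ℤ) := by
    have h : (U : Matrix (Fin 3) (Fin 3) ℤ) * P = U * (P * U) * (U⁻¹ : (Matrix _ _ ℤ)ˣ) := by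
      rw [mul_assoc, mul_assoc, Units.mul_inv, mul_one]
    rw [h, hPU, Matrix.mul_smul, mul_one, Matrix.smul_mul, Units.mul_inv]
  have hcol : ∀ i, c * ((U : Matrix (Fin 3) (Fin 3) ℤ) * Y) i 0 =
      (z • (1 : Matrix (Fin 3) (Fin 3) ℤ)) i 0 := by
    intro i
    rw [← hUP, Matrix.mul_apply, Matrix.mul_apply, Finset.mul_sum]
    refine Finset.sum_congr rfl fun j _ => ?_
    rw [hP]
    ring
  refine hH.eq_of_conj (Y := U * Y) hW ?_ ?_ ?_ ?_
  · rw [Matrix.det_mul]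
    exact ((Matrix.isUnit_iff_isUnit_det _).mp U.isUnit).mul hY
  · rw [← mul_assoc, hU.eq, mul_assoc, hconj, mul_assoc]
  · exact (mul_eq_zero.mp (by simpa using hcol 1)).resolve_left hc
  · exact (mul_eq_zero.mp (by simpa using hcol 2)).resolve_left hc

/-- The matrix with columns `e₁, M e₁, M² e₁`. -/
def krylovMatrix (M : Matrix (Fin 3) (Fin 3) ℤ) : Matrix (Fin 3) (Fin 3) ℤ :=
  Matrix.of fun i j => (M ^ (j : ℕ)) i 0

theorem det_krylovMatrix {M : Matrix (Fin 3) (Fin 3) ℤ} (hM : M 2 0 = 0) :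
    (krylovMatrix M).det = M 1 0 ^ 2 * M 2 1 := by
  simp [krylovMatrix, Matrix.det_fin_three, pow_two, Matrix.mul_apply, Fin.sum_univ_three, hM]
  ring

theorem det_mul_of_commute {H W Y P : Matrix (Fin 3) (Fin 3) ℤ} (hH : H 2 0 = 0)
    (hW : W 2 0 = 0) (hconj : H * Y = Y * W) (hPH : Commute P H) {c : ℤ}
    (hP : ∀ i, P i 0 = c * Y i 0) :
    P.det * (H 1 0 ^ 2 * H 2 1) = c ^ 3 * (Y.det * (W 1 0 ^ 2 * W 2 1)) := by
  have hpow : ∀ n : ℕ, H ^ n * Y = Y * W ^ n := by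
    intro n
    induction n with
    | zero => simp
    | succ n ih => rw [pow_succ, mul_assoc, hconj, ← mul_assoc, ih, mul_assoc, ← pow_succ]
  have key : P * krylovMatrix H = c • (Y * krylovMatrix W) := by
    ext i j
    have h1 : (P * krylovMatrix H) i j = (P * H ^ (j : ℕ)) i 0 := by
      simp [krylovMatrix, Matrix.mul_apply]
    have h2 : (Y * krylovMatrix W) i j = (Y * W ^ (j : ℕ)) i 0 := by
      simp [krylovMatrix, Matrix.mul_apply]
    rw [Matrix.smul_apply, h1, h2, ← hpow, (hPH.pow_right _).eq, Matrix.mul_apply,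
      Matrix.mul_apply, smul_eq_mul, Finset.mul_sum]
    refine Finset.sum_congr rfl fun k _ => ?_
    rw [hP]
    ring
  have h := congrArg Matrix.det key
  rw [Matrix.det_mul, Matrix.det_smul, Matrix.det_mul, det_krylovMatrix hH,
    det_krylovMatrix hW] at h
  simpa using h

theorem exists_coeffs_col {H : Matrix (Fin 3) (Fin 3) ℤ} (hH : H 2 0 = 0) (v : Fin 3 → ℤ) :
    ∃ w x y : ℤ, ∀ i, (w • H.adjugate + x • (1 : Matrix (Fin 3) (Fin 3) ℤ) + y • H) i 0 =
      H 1 0 ^ 2 * H 2 1 * v i := by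
  set L : Matrix (Fin 3) (Fin 3) ℤ := Matrix.of fun i =>
    ![H.adjugate i 0, (1 : Matrix (Fin 3) (Fin 3) ℤ) i 0, H i 0] with hL
  have hdet : L.det = H 1 0 ^ 2 * H 2 1 := by
    simp [hL, Matrix.det_fin_three, Matrix.adjugate_fin_three, hH]
    ring
  set u := L.adjugate *ᵥ v with hu
  have hLu : L *ᵥ u = L.det • v := by
    rw [hu, Matrix.mulVec_mulVec, Matrix.mul_adjugate, Matrix.smul_mulVec, Matrix.one_mulVec]
  refine ⟨u 0, u 1, u 2, fun i => ?_⟩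
  have h := congrFun hLu i
  rw [hdet] at h
  simp only [Matrix.mulVec, dotProduct, Fin.sum_univ_three, Pi.smul_apply, smul_eq_mul] at h
  rw [← h]
  simp only [hL, Matrix.add_apply, Matrix.smul_apply, Matrix.of_apply, smul_eq_mul,
    Matrix.cons_val]
  ring

theorem exists_pos_of_scaled (F : ℤ → ℤ) (G : ℝ → ℝ) (n : ℕ) (hG : Continuous G)
    (hG0 : 0 < G 0) (hF : ∀ t : ℤ, 0 < t → (F t : ℝ) = (t : ℝ) ^ n * G (1 / t)) :
    ∃ t : ℤ, 0 ≤ t ∧ 0 < F t := by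
  have hlim : Filter.Tendsto (fun m : ℕ => G (1 / ((m : ℝ) + 1))) Filter.atTop (nhds (G 0)) :=
    (hG.tendsto 0).comp tendsto_one_div_add_atTop_nhds_zero_nat
  obtain ⟨m, hm⟩ := (hlim.eventually (lt_mem_nhds hG0)).exists
  refine ⟨m + 1, by positivity, ?_⟩
  have h := hF (m + 1) (by positivity)
  push_cast at h
  have : (0 : ℝ) < F (m + 1) := by rw [h]; positivity
  exact_mod_cast this

theorem direction_of_disc_neg (τ σ p q : ℤ)
    (h : ∀ t : ℤ, 0 ≤ t → cubicDiscZ (-(τ + t * p)) (σ + t * q) (-1) < 0) :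
    (q = 0 ∧ 0 ≤ p) ∨ (p = 0 ∧ 0 ≤ q) := by
  by_contra hcon
  suffices hex : ∃ t : ℤ, 0 ≤ t ∧ 0 < cubicDiscZ (-(τ + t * p)) (σ + t * q) (-1) by
    obtain ⟨t, ht, ht'⟩ := hex
    exact absurd (h t ht) ht'.le.not_gt
  by_cases hq : q = 0
  · subst hq
    have hp : p < 0 := by
      by_contra hp
      exact hcon (Or.inl ⟨rfl, not_lt.mp hp⟩)
    refine exists_pos_of_scaled _ (fun x : ℝ => x * σ ^ 2 * (τ * x + p) ^ 2 - 4 * x ^ 3 * σ ^ 3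
      - 4 * (τ * x + p) ^ 3 + 18 * x ^ 2 * σ * (τ * x + p) - 27 * x ^ 3) 3 (by fun_prop) ?_ ?_
    · have : (p : ℝ) < 0 := by exact_mod_cast hp
      have := Odd.pow_neg (n := 3) (by decide) this
      simp
      linarith
    · intro t ht
      have ht' : (t : ℝ) ≠ 0 := by exact_mod_cast ht.ne'
      simp only [cubicDiscZ]
      push_cast
      field_simp
      ring
  by_cases hp : p = 0
  · subst hp
    have hq : q < 0 := by
      by_contra hq
      exact hcon (Or.inr ⟨rfl, not_lt.mp hq⟩)
    refine exists_pos_of_scaled _ (fun x : ℝ => x * τ ^ 2 * (σ * x + q) ^ 2 - 4 * x ^ 3 * τ ^ 3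
      - 4 * (σ * x + q) ^ 3 + 18 * x ^ 2 * τ * (σ * x + q) - 27 * x ^ 3) 3 (by fun_prop) ?_ ?_
    · have : (q : ℝ) < 0 := by exact_mod_cast hq
      have := Odd.pow_neg (n := 3) (by decide) this
      simp
      linarith
    · intro t ht
      have ht' : (t : ℝ) ≠ 0 := by exact_mod_cast ht.ne'
      simp only [cubicDiscZ]
      push_cast
      field_simp
      ring
  · refine exists_pos_of_scaled _ (fun x : ℝ => (τ * x + p) ^ 2 * (σ * x + q) ^ 2
      - 4 * x * (τ * x + p) ^ 3 - 4 * x * (σ * x + q) ^ 3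
      + 18 * x ^ 2 * (τ * x + p) * (σ * x + q) - 27 * x ^ 4) 4 (by fun_prop) ?_ ?_
    · have hp' : (p : ℝ) ≠ 0 := by exact_mod_cast hp
      have hq' : (q : ℝ) ≠ 0 := by exact_mod_cast hq
      simp
      positivity
    · intro t ht
      have ht' : (t : ℝ) ≠ 0 := by exact_mod_cast ht.ne'
      simp only [cubicDiscZ]
      push_cast
      field_simp
      ring

theorem IsPerfect.eq_of_reduced {s c : ℤ} :
    ∃ T : ℤ, ∀ H W : Matrix (Fin 3) (Fin 3) ℤ, IsPerfect H → H 1 0 ^ 2 * H 2 1 = c →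
      (H.adjugate.trace = s ∧ T ≤ H.trace ∨ H.trace = s ∧ T ≤ H.adjugate.trace) →
      IsReducedHess W → IntegerConjugate H W → W = H := by
  obtain ⟨T, hT⟩ := exists_mul_zpow_eq_smul_one s (c ^ 3)
  refine ⟨T, fun H W hH hc hcase ⟨hW, hmin⟩ ⟨X, hX, hXH⟩ => ?_⟩
  obtain ⟨hH0, ⟨hH1, hH2⟩, ⟨hH3, hH4⟩, -⟩ := hH.bounds
  obtain ⟨hW0, ⟨hW1, hW2⟩, ⟨hW3, hW4⟩, -⟩ := hW.bounds
  have hH10 : 0 < H 1 0 := by linarith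
  have hH21 : 0 < H 2 1 := by linarith
  have hW10 : 0 < W 1 0 := by linarith
  have hW21 : 0 < W 2 1 := by linarith
  have hconj : H * X⁻¹ = X⁻¹ * W := by
    rw [← Matrix.nonsing_inv_mul_cancel_left X (H * X⁻¹) hX, ← mul_assoc X, hXH,
      Matrix.mul_nonsing_inv_cancel_right X W hX]
  have hY : IsUnit (X⁻¹).det := Matrix.isUnit_nonsing_inv_det X hX
  have hle : W 1 0 ^ 2 * W 2 1 ≤ c := by
    have h := hmin H hH ⟨X⁻¹, hY, hconj.symm⟩
    rwa [hessComplexity_three, hessComplexity_three, abs_of_pos hH10, abs_of_pos hH21,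
      abs_of_pos hW10, abs_of_pos hW21, hc] at h
  have hWpos : 0 < W 1 0 ^ 2 * W 2 1 := by positivity
  have hcpos : 0 < c := by linarith
  obtain ⟨w, x, y, hP⟩ := exists_coeffs_col hH0 fun i => X⁻¹ i 0
  rw [hc] at hP
  set P := w • H.adjugate + x • (1 : Matrix (Fin 3) (Fin 3) ℤ) + y • H with hPdef
  have hadj : Commute H.adjugate H := by
    rw [commute_iff_eq, Matrix.adjugate_mul, Matrix.mul_adjugate]
  have hPH : Commute P H :=
    ((hadj.smul_left w).add_left ((Commute.one_left H).smul_left x)).add_left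
      ((Commute.refl H).smul_left y)
  have hdet := det_mul_of_commute hH0 hW0 hconj hPH hP
  rw [hc] at hdet
  have hdet' : |P.det| = c ^ 2 * (W 1 0 ^ 2 * W 2 1) := by
    have h := congrArg abs hdet
    rw [abs_mul, abs_mul, abs_mul, Int.isUnit_iff_abs_eq.mp hY, one_mul, abs_of_pos hcpos,
      abs_of_pos hWpos, abs_of_pos (pow_pos hcpos 3)] at h
    exact mul_right_cancel₀ hcpos.ne' (by linarith)
  have hPne : P.det ≠ 0 := by
    rw [← abs_pos, hdet']
    positivity
  have hPle : |P.det| ≤ c ^ 3 := by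
    rw [hdet', pow_succ c 2]
    exact mul_le_mul_of_nonneg_left hle (by positivity)
  symm
  rcases hcase with ⟨hs, htr⟩ | ⟨hs, htr⟩
  · obtain ⟨k, z, hz⟩ := hT H hH.1 hs htr w x y hPne hPle
    exact hH.eq_of_mul_unit_eq_smul hW hY hconj hcpos.ne' hP _
      (Commute.units_zpow_right (Commute.refl H) k) hz
  · have hdet1 : H.adjugate.det = 1 := by rw [Matrix.det_adjugate, hH.1, one_pow]
    have hadj2 := adjugate_adjugate_of_det_one H hH.1
    have hP' : P = y • H.adjugate.adjugate + x • (1 : Matrix (Fin 3) (Fin 3) ℤ)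
        + w • H.adjugate := by
      rw [hadj2, hPdef]
      abel
    rw [hP'] at hPne hPle
    obtain ⟨k, z, hz⟩ := hT H.adjugate hdet1 (by rw [hadj2, hs]) htr y x w hPne hPle
    rw [← hP'] at hz
    exact hH.eq_of_mul_unit_eq_smul hW hY hconj hcpos.ne' hP _
      (Commute.units_zpow_right (u := unitOfDetOne H.adjugate hdet1) hadj.symm k) hz

/-- for a perfect Hessenberg type, any NRS-ray contains only finitely
many reduced matrices integer conjugate to some other reduced matrix: from some moment
on, the only reduced perfect Hessenberg matrix integer conjugate to a matrix of the ray
is that matrix itself. -/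
theorem statement12 (a11 a21 a12 a22 a32 a13 a23 a33 : ℤ)
    (h11 : 0 ≤ a11) (h11' : a11 < a21) (h12 : 0 ≤ a12) (h12' : a12 < a32)
    (h22 : 0 ≤ a22) (h22' : a22 < a32)
    (hdet : (HfamZ a11 a21 a12 a22 a32 a13 a23 a33 0 0).det = 1)
    (d : ℤ × ℤ) (hd : d ≠ 0) (m₀ n₀ : ℤ)
    (hray : ∀ t : ℤ, 0 ≤ t →
      IsNRS (HfamZ a11 a21 a12 a22 a32 a13 a23 a33 (m₀ + t * d.1) (n₀ + t * d.2))) :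
    ∃ T : ℤ, ∀ t : ℤ, T ≤ t →
      ∀ W : Matrix (Fin 3) (Fin 3) ℤ, IsReducedHess W →
        IntegerConjugate (HfamZ a11 a21 a12 a22 a32 a13 a23 a33 (m₀ + t * d.1) (n₀ + t * d.2)) W →
        W = HfamZ a11 a21 a12 a22 a32 a13 a23 a33 (m₀ + t * d.1) (n₀ + t * d.2) := by
  set M : ℤ → Matrix (Fin 3) (Fin 3) ℤ := fun t =>
    HfamZ a11 a21 a12 a22 a32 a13 a23 a33 (m₀ + t * d.1) (n₀ + t * d.2) with hM
  have hdetM : ∀ t, (M t).det = 1 := by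
    intro t
    rw [← hdet]
    simp [hM, HfamZ, Matrix.det_fin_three]
    ring
  have hperf : ∀ t, 0 ≤ t → IsPerfect (M t) := by
    intro t ht
    refine ⟨hdetM t, ?_, (hray t ht).1, ?_⟩
    · intro i j hij
      fin_cases i <;> fin_cases j <;> simp at hij
      simp [hM, HfamZ]
    · intro i j hij hj
      fin_cases i <;> fin_cases j <;> simp [hM, HfamZ, subdiag] at * <;> omega
  have ha21 : 0 < a21 := by linarith
  have ha32 : 0 < a32 := by linarith
  obtain ⟨τ, hτ⟩ : ∃ τ : ℤ, ∀ t, (M t).trace = τ + t * (a32 * d.2) :=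
    ⟨a11 + a22 + (a33 + a32 * n₀), fun t => by
      simp [hM, HfamZ, Matrix.trace, Fin.sum_univ_three]
      ring⟩
  obtain ⟨σ, hσ⟩ : ∃ σ : ℤ, ∀ t,
      (M t).adjugate.trace = σ + t * (a32 * (a11 * d.2 - a21 * d.1)) :=
    ⟨a11 * a22 - a12 * a21 + a11 * (a33 + a32 * n₀) + a22 * (a33 + a32 * n₀)
        - a32 * (a23 + a21 * m₀ + a22 * n₀), fun t => by
      simp [hM, HfamZ, Matrix.trace, Fin.sum_univ_three, Matrix.adjugate_fin_three]
      ring⟩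
  have hdisc : ∀ t : ℤ, 0 ≤ t → cubicDiscZ (-(τ + t * (a32 * d.2)))
      (σ + t * (a32 * (a11 * d.2 - a21 * d.1))) (-1) < 0 := by
    intro t ht
    have h := (hray t ht).2
    change matDiscZ (M t) < 0 at h
    rw [matDiscZ, hdetM] at h
    rw [← hτ, ← hσ]
    convert h using 2
    · simp [Matrix.trace, Fin.sum_univ_three]
    · simp [Matrix.trace, Fin.sum_univ_three, Matrix.adjugate_fin_three]
      ring
  have growth : ∀ (T b r : ℤ), 0 < r → ∀ t, |T| + |b| ≤ t → T ≤ b + t * r := by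
    intro T b r hr t ht
    have ht0 : 0 ≤ t := by linarith [abs_nonneg T, abs_nonneg b]
    have := le_mul_of_one_le_right ht0 (Int.add_one_le_iff.mpr hr)
    linarith [le_abs_self T, neg_abs_le b]
  rcases direction_of_disc_neg _ _ _ _ hdisc with ⟨hq, hp⟩ | ⟨hp, hq⟩
  · have hpos : 0 < a32 * d.2 := by
      refine lt_of_le_of_ne hp fun h0 => hd ?_
      have h2 : d.2 = 0 := (mul_eq_zero.mp h0.symm).resolve_left ha32.ne'
      rw [h2, mul_zero, zero_sub, mul_neg, neg_eq_zero] at hq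
      have h1 : d.1 = 0 := (mul_eq_zero.mp
        ((mul_eq_zero.mp hq).resolve_left ha32.ne')).resolve_left ha21.ne'
      exact Prod.ext h1 h2
    obtain ⟨T, hT⟩ := IsPerfect.eq_of_reduced (s := σ) (c := a21 ^ 2 * a32)
    refine ⟨|T| + |τ|, fun t ht W hW hconj => hT (M t) W
      (hperf t (by linarith [abs_nonneg T, abs_nonneg τ])) (by simp [hM, HfamZ])
      (Or.inl ⟨?_, ?_⟩) hW hconj⟩
    · rw [hσ, hq, mul_zero, add_zero]
    · rw [hτ]
      exact growth _ _ _ hpos t ht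
  · have h2 : d.2 = 0 := (mul_eq_zero.mp hp).resolve_left ha32.ne'
    have hpos : 0 < a32 * (a11 * d.2 - a21 * d.1) := by
      refine lt_of_le_of_ne hq fun h0 => hd ?_
      rw [h2, mul_zero, zero_sub, mul_neg, zero_eq_neg] at h0
      have h1 : d.1 = 0 := (mul_eq_zero.mp
        ((mul_eq_zero.mp h0).resolve_left ha32.ne')).resolve_left ha21.ne'
      exact Prod.ext h1 h2
    obtain ⟨T, hT⟩ := IsPerfect.eq_of_reduced (s := τ) (c := a21 ^ 2 * a32)
    refine ⟨|T| + |σ|, fun t ht W hW hconj => hT (M t) W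
      (hperf t (by linarith [abs_nonneg T, abs_nonneg σ])) (by simp [hM, HfamZ])
      (Or.inr ⟨?_, ?_⟩) hW hconj⟩
    · rw [hτ, hp, mul_zero, add_zero]
    · rw [hσ]
      exact growth _ _ _ hpos t ht
end

section
/- Fix a perfect 3×3 Hessenberg type Ω and base matrix M₀ as in the context, with integer family H(m,n) ⊂ SL(3,ℤ). Call a nonzero vector d ∈ ℤ² an asymptotic direction for NRS(Ω) if there exists (m₀,n₀) ∈ ℤ² such that H((m₀,n₀) + t·d) is an NRS-matrix for every integer t ≥ 0. Then d is an asymptotic direction if and only if d is a positive rational multiple of (−1,0) or a positive rational multiple of (a₁₁, a₂₁); in particular there are exactly two asymptotic directions up to positive scaling. -/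
open Matrix Polynomial

/-- A monic integer cubic with constant coefficient `-1` and no root `±1`, given as the
characteristic polynomial of a matrix, is irreducible over `ℚ`. -/
theorem irreducible_charpoly_of_eval_eq {M : Matrix (Fin 3) (Fin 3) ℤ} {x y : ℤ}
    (hM : ∀ z : ℤ, M.charpoly.eval z = z ^ 3 - x * z ^ 2 + y * z - 1)
    (hxy : x ≠ y) (hxy' : x + y ≠ -2) :
    Irreducible (M.charpoly.map (Int.castRingHom ℚ)) := by
  have hmonic := M.charpoly_monic
  have hdeg : (M.charpoly.map (Int.castRingHom ℚ)).natDegree = 3 := by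
    rw [hmonic.natDegree_map, charpoly_natDegree_eq_dim, Fintype.card_fin]
  rw [(hmonic.map _).irreducible_iff_roots_eq_zero_of_degree_le_three (by omega) (by omega)]
  refine Multiset.eq_zero_of_forall_notMem fun r hr => ?_
  have hroot : aeval r M.charpoly = 0 := by
    have := (mem_roots'.mp hr).2
    rwa [IsRoot.def, eval_map, ← algebraMap_int_eq, ← aeval_def] at this
  obtain ⟨z, rfl⟩ := isInteger_of_is_root_of_monic hmonic hroot
  rw [aeval_algebraMap_apply, coe_aeval_eq_eval, map_eq_zero_iff _ (algebraMap ℤ ℚ).injective_int,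
    hM] at hroot
  have hz : z ∣ 1 := ⟨z ^ 2 - x * z + y, by linarith⟩
  rcases Int.isUnit_iff.mp (isUnit_of_dvd_one hz) with rfl | rfl
  · exact hxy (by linarith)
  · exact hxy' (by linarith)

theorem cubicDiscZ_swap (x y : ℤ) : cubicDiscZ (-x) y (-1) = cubicDiscZ (-y) x (-1) := by
  unfold cubicDiscZ
  ring

theorem exists_forall_ge_cubicDiscZ_neg (y : ℤ) :
    ∃ K : ℤ, ∀ x, K ≤ x → cubicDiscZ (-x) y (-1) < 0 ∧ x ≠ y ∧ x + y ≠ -2 := by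
  refine ⟨y ^ 2 + 5 * |y| + 5, fun x hx => ?_⟩
  have hy := abs_nonneg y
  have hle := le_abs_self y
  have hneg := neg_abs_le y
  have hsq := sq_nonneg y
  refine ⟨?_, by intro h; linarith, by intro h; linarith⟩
  have hx5 : 5 ≤ x := by linarith
  have hxy : 5 * |y| ≤ x := by linarith
  have hxsq : y ^ 2 ≤ x := by linarith
  have quartic : x ^ 2 * y ^ 2 ≤ x ^ 2 * x := mul_le_mul_of_nonneg_left hxsq (sq_nonneg x)
  have cube : -y ^ 3 ≤ x ^ 3 := by
    calc -y ^ 3 = (-y) ^ 3 := by ring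
      _ ≤ |y| ^ 3 := (Odd.pow_le_pow (by decide)).mpr (neg_le_abs y)
      _ ≤ x ^ 3 := pow_le_pow_left₀ hy (by linarith) 3
  have cube' : -(125 * y ^ 3) ≤ x ^ 3 := by
    calc -(125 * y ^ 3) = (5 * -y) ^ 3 := by ring
      _ ≤ (5 * |y|) ^ 3 := (Odd.pow_le_pow (by decide)).mpr (by linarith)
      _ ≤ x ^ 3 := pow_le_pow_left₀ (by positivity) hxy 3
  have mixed : 5 * (x * y) ≤ x ^ 2 := by nlinarith
  have square : 5 * x ^ 2 ≤ x ^ 3 := by nlinarith [sq_nonneg x]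
  have pos : 0 < x ^ 3 := by positivity
  unfold cubicDiscZ
  nlinarith

theorem exists_nonneg_quartic_pos {c₄ : ℤ} (c₃ c₂ c₁ c₀ : ℤ) (h : 0 < c₄) :
    ∃ t : ℤ, 0 ≤ t ∧ 0 < c₄ * t ^ 4 + c₃ * t ^ 3 + c₂ * t ^ 2 + c₁ * t + c₀ := by
  set t := |c₃| + |c₂| + |c₁| + |c₀| + 1 with ht
  have ht1 : 1 ≤ t := by have := abs_nonneg c₃; have := abs_nonneg c₂; have := abs_nonneg c₁; have := abs_nonneg c₀; linarith
  refine ⟨t, by linarith, ?_⟩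
  have p1 : t ≤ t ^ 3 := by nlinarith [sq_nonneg t]
  have p2 : t ^ 2 ≤ t ^ 3 := by nlinarith [sq_nonneg t]
  have p0 : 1 ≤ t ^ 3 := by linarith
  have e4 : t ^ 4 ≤ c₄ * t ^ 4 := le_mul_of_one_le_left (by positivity) h
  have bound (c s : ℤ) (hs : 0 ≤ s) (hst : s ≤ t ^ 3) : -(|c| * t ^ 3) ≤ c * s :=
    calc -(|c| * t ^ 3) ≤ -(|c| * s) := neg_le_neg (mul_le_mul_of_nonneg_left hst (abs_nonneg c))
      _ = -|c| * s := by ring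
      _ ≤ c * s := mul_le_mul_of_nonneg_right (neg_abs_le c) hs
  have e3 := bound c₃ (t ^ 3) (by positivity) le_rfl
  have e2 := bound c₂ (t ^ 2) (by positivity) p2
  have e1 := bound c₁ t (by linarith) p1
  have e0 := bound c₀ 1 zero_le_one p0
  have key : t ^ 4 = |c₃| * t ^ 3 + |c₂| * t ^ 3 + |c₁| * t ^ 3 + |c₀| * t ^ 3 + t ^ 3 := by
    calc t ^ 4 = (|c₃| + |c₂| + |c₁| + |c₀| + 1) * t ^ 3 := by rw [← ht]; ring
      _ = _ := by ring
  linarith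

theorem exists_nonneg_cubic_pos {c₃ : ℤ} (c₂ c₁ c₀ : ℤ) (h : 0 < c₃) :
    ∃ t : ℤ, 0 ≤ t ∧ 0 < c₃ * t ^ 3 + c₂ * t ^ 2 + c₁ * t + c₀ := by
  obtain ⟨t, ht, hpos⟩ := exists_nonneg_quartic_pos c₂ c₁ c₀ 0 h
  exact ⟨t, ht, pos_of_mul_pos_right (hpos.trans_eq (by ring)) ht⟩

theorem exists_cubicDiscZ_pos_of_ne_zero (u v : ℤ) {α β : ℤ} (hα : α ≠ 0) (hβ : β ≠ 0) :
    ∃ t : ℤ, 0 ≤ t ∧ 0 < cubicDiscZ (-(u + t * α)) (v + t * β) (-1) := by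
  obtain ⟨t, ht, hpos⟩ := exists_nonneg_quartic_pos (c₄ := α ^ 2 * β ^ 2)
    (2 * u * α * β ^ 2 + 2 * v * β * α ^ 2 - 4 * α ^ 3 - 4 * β ^ 3)
    (u ^ 2 * β ^ 2 + 4 * u * α * v * β + v ^ 2 * α ^ 2 - 12 * u * α ^ 2 - 12 * v * β ^ 2
      + 18 * α * β)
    (2 * u ^ 2 * v * β + 2 * u * α * v ^ 2 - 12 * u ^ 2 * α - 12 * v ^ 2 * β
      + 18 * (u * β + v * α))
    (u ^ 2 * v ^ 2 - 4 * u ^ 3 - 4 * v ^ 3 + 18 * u * v - 27) (by positivity)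
  refine ⟨t, ht, hpos.trans_eq ?_⟩
  unfold cubicDiscZ
  ring

theorem exists_cubicDiscZ_pos_of_neg (u v : ℤ) {α : ℤ} (hα : α < 0) :
    ∃ t : ℤ, 0 ≤ t ∧ 0 < cubicDiscZ (-(u + t * α)) v (-1) := by
  obtain ⟨t, ht, hpos⟩ := exists_nonneg_cubic_pos (c₃ := 4 * (-α) ^ 3)
    (v ^ 2 * α ^ 2 - 12 * u * α ^ 2)
    (2 * u * α * v ^ 2 - 12 * u ^ 2 * α + 18 * v * α)
    (u ^ 2 * v ^ 2 - 4 * u ^ 3 - 4 * v ^ 3 + 18 * u * v - 27)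
    (by have := neg_pos.mpr hα; positivity)
  refine ⟨t, ht, hpos.trans_eq ?_⟩
  unfold cubicDiscZ
  ring

/-- The ray `t ↦ (u + tα, v + tβ)` in the plane of coefficients of `z³ - x z² + y z - 1` can only
stay in the region of negative discriminant along a positive coordinate direction. -/
theorem coordinate_direction_of_forall_cubicDiscZ_neg {u v α β : ℤ} (hne : α ≠ 0 ∨ β ≠ 0)
    (h : ∀ t : ℤ, 0 ≤ t → cubicDiscZ (-(u + t * α)) (v + t * β) (-1) < 0) :
    (α = 0 ∧ 0 < β) ∨ (β = 0 ∧ 0 < α) := by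
  by_contra hcon
  have hex : ∃ t : ℤ, 0 ≤ t ∧ 0 < cubicDiscZ (-(u + t * α)) (v + t * β) (-1) := by
    by_cases hα : α = 0
    · subst hα
      obtain ⟨t, ht, hpos⟩ := exists_cubicDiscZ_pos_of_neg v u (α := β) (by omega)
      exact ⟨t, ht, by simpa [cubicDiscZ_swap u] using hpos⟩
    · by_cases hβ : β = 0
      · subst hβ
        obtain ⟨t, ht, hpos⟩ := exists_cubicDiscZ_pos_of_neg u v (α := α) (by omega)
        exact ⟨t, ht, by simpa using hpos⟩
      · exact exists_cubicDiscZ_pos_of_ne_zero u v hα hβ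
  obtain ⟨t, ht, hpos⟩ := hex
  exact (h t ht).not_gt hpos

section HessenbergFamily

variable {a11 a21 a12 a22 a32 a13 a23 a33 : ℤ}

theorem det_HfamZ (m n : ℤ) : (HfamZ a11 a21 a12 a22 a32 a13 a23 a33 m n).det =
    (HfamZ a11 a21 a12 a22 a32 a13 a23 a33 0 0).det := by
  simp [HfamZ, det_fin_three]
  ring

theorem charpoly_eval_HfamZ (hdet : (HfamZ a11 a21 a12 a22 a32 a13 a23 a33 0 0).det = 1)
    (m n z : ℤ) :
    (HfamZ a11 a21 a12 a22 a32 a13 a23 a33 m n).charpoly.eval z =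
      z ^ 3 - (a11 + a22 + a33 + a32 * n) * z ^ 2
        + (a11 * a22 - a12 * a21 + (a11 + a22) * a33 - a32 * a23 + a32 * (a11 * n - a21 * m)) * z
        - 1 := by
  rw [← hdet, eval_charpoly, scalar_apply]
  simp [HfamZ, det_fin_three]
  ring

theorem matDiscZ_HfamZ (hdet : (HfamZ a11 a21 a12 a22 a32 a13 a23 a33 0 0).det = 1) (m n : ℤ) :
    matDiscZ (HfamZ a11 a21 a12 a22 a32 a13 a23 a33 m n) =
      cubicDiscZ (-(a11 + a22 + a33 + a32 * n))
        (a11 * a22 - a12 * a21 + (a11 + a22) * a33 - a32 * a23 + a32 * (a11 * n - a21 * m))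
        (-1) := by
  rw [matDiscZ, det_HfamZ, hdet]
  congr 1 <;> simp [HfamZ] <;> ring

theorem isNRS_HfamZ (hdet : (HfamZ a11 a21 a12 a22 a32 a13 a23 a33 0 0).det = 1) {m n x y : ℤ}
    (hx : a11 + a22 + a33 + a32 * n = x)
    (hy : a11 * a22 - a12 * a21 + (a11 + a22) * a33 - a32 * a23 + a32 * (a11 * n - a21 * m) = y)
    (hneg : cubicDiscZ (-x) y (-1) < 0) (hxy : x ≠ y) (hxy' : x + y ≠ -2) :
    IsNRS (HfamZ a11 a21 a12 a22 a32 a13 a23 a33 m n) := by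
  subst hx hy
  exact ⟨irreducible_charpoly_of_eval_eq (charpoly_eval_HfamZ hdet m n) hxy hxy',
    by rwa [matDiscZ_HfamZ hdet]⟩

end HessenbergFamily

theorem exists_forall_ge_add_mul (u K : ℤ) {c : ℤ} (hc : 0 < c) :
    ∃ N : ℤ, ∀ t : ℤ, 0 ≤ t → K ≤ u + (N + t) * c := by
  refine ⟨|K - u|, fun t ht => ?_⟩
  nlinarith [le_abs_self (K - u), abs_nonneg (K - u)]

/-- a nonzero `d ∈ ℤ²` is an asymptotic direction for `NRS(Ω)`
(i.e. some integer ray in direction `d` consists entirely of NRS-matrices) iff `d`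
is a positive rational multiple of `(−1,0)` or of `(a₁₁,a₂₁)`; in particular there
are exactly two asymptotic directions up to positive scaling. -/
theorem statement13 (a11 a21 a12 a22 a32 a13 a23 a33 : ℤ)
    (h11 : 0 ≤ a11) (h11' : a11 < a21) (h12 : 0 ≤ a12) (h12' : a12 < a32)
    (h22 : 0 ≤ a22) (h22' : a22 < a32)
    (hdet : (HfamZ a11 a21 a12 a22 a32 a13 a23 a33 0 0).det = 1)
    (d : ℤ × ℤ) (hd : d ≠ 0) :
    (∃ m₀ n₀ : ℤ, ∀ t : ℤ, 0 ≤ t →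
        IsNRS (HfamZ a11 a21 a12 a22 a32 a13 a23 a33 (m₀ + t * d.1) (n₀ + t * d.2))) ↔
      ((∃ q : ℚ, 0 < q ∧ (d.1 : ℚ) = q * (-1) ∧ (d.2 : ℚ) = q * 0) ∨
       (∃ q : ℚ, 0 < q ∧ (d.1 : ℚ) = q * a11 ∧ (d.2 : ℚ) = q * a21)) := by
  obtain ⟨d₁, d₂⟩ := d
  have h21 : 0 < a21 := by linarith
  have h32 : 0 < a32 := by linarith
  have h21' : (0 : ℚ) < a21 := by exact_mod_cast h21
  constructor
  · rintro ⟨m, n, h⟩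
    have hray : ∀ t : ℤ, 0 ≤ t →
        cubicDiscZ (-(a11 + a22 + a33 + a32 * n + t * (a32 * d₂)))
          (a11 * a22 - a12 * a21 + (a11 + a22) * a33 - a32 * a23 + a32 * (a11 * n - a21 * m)
            + t * (a32 * (a11 * d₂ - a21 * d₁))) (-1) < 0 := by
      intro t ht
      have := (h t ht).2
      rw [matDiscZ_HfamZ hdet] at this
      convert this using 2 <;> ring
    have hne : a32 * d₂ ≠ 0 ∨ a32 * (a11 * d₂ - a21 * d₁) ≠ 0 := by
      by_contra! hzero
      have hd₂ : d₂ = 0 := by simpa [h32.ne'] using hzero.1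
      have hd₁ : d₁ = 0 := by simpa [h32.ne', h21.ne', hd₂] using hzero.2
      exact hd (by simp [hd₁, hd₂])
    rcases coordinate_direction_of_forall_cubicDiscZ_neg hne hray with ⟨hα, hβ⟩ | ⟨hβ, hα⟩
    · have hd₂ : d₂ = 0 := by simpa [h32.ne'] using hα
      have hd₁ : d₁ < 0 := by
        have := pos_of_mul_pos_right hβ h32.le
        rw [hd₂] at this
        nlinarith
      refine Or.inl ⟨-d₁, ?_, ?_, ?_⟩
      · simpa using hd₁
      · simp
      · simp [hd₂]
    · have hd₂ : 0 < d₂ := pos_of_mul_pos_right hα h32.le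
      have hd₁ : a11 * d₂ - a21 * d₁ = 0 := by simpa [h32.ne'] using hβ
      have hd₁' : (a11 : ℚ) * d₂ - a21 * d₁ = 0 := by exact_mod_cast hd₁
      have hd₂' : (0 : ℚ) < d₂ := by exact_mod_cast hd₂
      refine Or.inr ⟨d₂ / a21, by positivity, ?_, ?_⟩
      · simp only
        field_simp
        linarith
      · simp only
        field_simp
  · rintro (⟨q, hq, hd₁, hd₂⟩ | ⟨q, hq, hd₁, hd₂⟩)
    · have hd₂' : d₂ = 0 := by simpa using hd₂
      have hd₁' : d₁ < 0 := by
        have : (d₁ : ℚ) < 0 := by simp only at hd₁; linarith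
        exact_mod_cast this
      subst hd₂'
      obtain ⟨K, hK⟩ := exists_forall_ge_cubicDiscZ_neg (a11 + a22 + a33)
      obtain ⟨N, hN⟩ := exists_forall_ge_add_mul
        (a11 * a22 - a12 * a21 + (a11 + a22) * a33 - a32 * a23) K
        (mul_pos (mul_pos h32 h21) (neg_pos.mpr hd₁'))
      refine ⟨N * d₁, 0, fun t ht => ?_⟩
      obtain ⟨hneg, hxy, hxy'⟩ := hK _ (hN t ht)
      exact isNRS_HfamZ hdet (by simp) (by ring) ((cubicDiscZ_swap _ _).trans_lt hneg) hxy.symm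
        (by rwa [add_comm])
    · simp only at hd₁ hd₂
      have hd₂' : 0 < d₂ := by
        have : (0 : ℚ) < d₂ := by rw [hd₂]; positivity
        exact_mod_cast this
      have hd₁' : a11 * d₂ - a21 * d₁ = 0 := by
        have : (a11 : ℚ) * d₂ - a21 * d₁ = 0 := by rw [hd₁, hd₂]; ring
        exact_mod_cast this
      obtain ⟨K, hK⟩ := exists_forall_ge_cubicDiscZ_neg
        (a11 * a22 - a12 * a21 + (a11 + a22) * a33 - a32 * a23)
      obtain ⟨N, hN⟩ := exists_forall_ge_add_mul (a11 + a22 + a33) K (mul_pos h32 hd₂')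
      refine ⟨N * d₁, N * d₂, fun t ht => ?_⟩
      obtain ⟨hneg, hxy, hxy'⟩ := hK _ (hN t ht)
      exact isNRS_HfamZ hdet (by ring) (by linear_combination a32 * (N + t) * hd₁') hneg hxy hxy'
end

section
/- Let m, n ∈ ℤ with m + n odd, and let M = [[0,1,n+1],[1,0,m],[0,2,2n+1]] ∈ SL(3,ℤ). Then for every integer vector v ∈ ℤ³, the determinant det[v, Mv, M²v] (of the 3×3 matrix with columns v, Mv, M²v) is even. Equivalently, the Markoff–Davenport characteristic Δ(M|v) takes only even values on ℤ³. -/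
open Matrix Polynomial

/-- for `m + n` odd and `M = [[0,1,n+1],[1,0,m],[0,2,2n+1]] ∈ SL(3,ℤ)`,
the determinant `det[v, Mv, M²v]` is even for every integer vector `v`; equivalently,
the Markoff–Davenport characteristic `Δ(M|v)` takes only even values on ℤ³. -/
theorem statement15 (m n : ℤ) (hodd : Odd (m + n)) :
    (!![0, 1, n + 1; 1, 0, m; 0, 2, 2 * n + 1] : Matrix (Fin 3) (Fin 3) ℤ).det = 1 ∧
    ∀ v : Fin 3 → ℤ,
      Even ((Matrix.of fun i j : Fin 3 =>
        (((!![0, 1, n + 1; 1, 0, m; 0, 2, 2 * n + 1] : Matrix (Fin 3) (Fin 3) ℤ) ^ (j : ℕ)).mulVec v)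
          i).det) := by
  obtain ⟨k, hk⟩ := hodd
  obtain rfl : m = 2 * k + 1 - n := by linarith
  refine ⟨by simp [det_fin_three]; ring, fun v => ?_⟩
  -- `M ^ 2 ≡ 1` modulo `2`, so `M ^ 2 v = v + 2 w`, and the determinant is `2 * det [v, M v, w]`.
  rw [even_iff_two_dvd]
  refine ⟨(!![v 0, v 1 + (n + 1) * v 2, (n + 1) * v 1 + (n ^ 2 + n + k + 1) * v 2;
    v 1, v 0 + (2 * k + 1 - n) * v 2,
      (2 * k + 1 - n) * v 1 + (k + 1 + (2 * k + 1 - n) * n) * v 2;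
    v 2, 2 * v 1 + (2 * n + 1) * v 2,
      v 0 + (2 * n + 1) * v 1 + (2 * k + 1 - n + 2 * n ^ 2 + 2 * n) * v 2] :
    Matrix (Fin 3) (Fin 3) ℤ).det, ?_⟩
  simp [det_fin_three, pow_two, mulVec, dotProduct, Fin.sum_univ_three, mul_apply]
  ring
end

section
/- Let M ∈ SL(2,ℤ) be a matrix whose characteristic polynomial has no real roots (equivalently, |trace M| ≤ 1). Then M is integer conjugate to exactly one of the three matrices [[1,1],[−1,0]], [[0,1],[−1,0]], [[0,1],[−1,−1]]; moreover these three matrices are pairwise not integer conjugate. -/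
open Matrix Polynomial

/-- A positive definite integral binary form with discriminant at least `-4` represents `1`. -/
theorem exists_binaryForm_eq_one (p q r : ℤ) (hp : 0 < p) (hlt : q ^ 2 < 4 * p * r)
    (hle : 4 * p * r ≤ q ^ 2 + 4) : ∃ x y : ℤ, p * x ^ 2 + q * x * y + r * y ^ 2 = 1 := by
  induction hn : q.natAbs using Nat.strong_induction_on generalizing p q r with
  | _ n ih =>
    have hr : 0 < r := by
      by_contra! h
      nlinarith [sq_nonneg q]
    rcases lt_or_ge p |q| with hpq | hpq
    · rcases abs_cases q with ⟨hq, _⟩ | ⟨hq, _⟩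
      · obtain ⟨x, y, h⟩ := ih (q - 2 * p).natAbs (by omega) p (q - 2 * p) (p - q + r) hp
          (by linear_combination hlt) (by linear_combination hle) rfl
        exact ⟨x - y, y, by linear_combination h⟩
      · obtain ⟨x, y, h⟩ := ih (q + 2 * p).natAbs (by omega) p (q + 2 * p) (p + q + r) hp
          (by linear_combination hlt) (by linear_combination hle) rfl
        exact ⟨x + y, y, by linear_combination h⟩
    rcases lt_or_ge r |q| with hrq | hrq
    · rcases abs_cases q with ⟨hq, _⟩ | ⟨hq, _⟩
      · obtain ⟨x, y, h⟩ := ih (q - 2 * r).natAbs (by omega) (p - q + r) (q - 2 * r) r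
          (by nlinarith) (by linear_combination hlt) (by linear_combination hle) rfl
        exact ⟨x, y - x, by linear_combination h⟩
      · obtain ⟨x, y, h⟩ := ih (q + 2 * r).natAbs (by omega) (p + q + r) (q + 2 * r) r
          (by nlinarith) (by linear_combination hlt) (by linear_combination hle) rfl
        exact ⟨x, y + x, by linear_combination h⟩
    have hq2 : q ^ 2 ≤ p * r := by
      rw [← sq_abs, sq]
      exact mul_le_mul hpq hrq (abs_nonneg q) hp.le
    have hpr : p = 1 ∨ r = 1 := by
      by_contra! h
      have hp2 : 2 ≤ p := by omega
      have hr2 : 2 ≤ r := by omega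
      nlinarith
    rcases hpr with rfl | rfl
    · exact ⟨1, 0, by ring⟩
    · exact ⟨0, 1, by ring⟩

/-- An integral matrix of determinant one with `|trace| < 2` has a cyclic row vector over `ℤ`. -/
theorem exists_isUnit_cyclic (a b c d : ℤ) (hdet : a * d - b * c = 1)
    (ht : (a + d) ^ 2 < 4) : ∃ x y : ℤ, IsUnit (b * x ^ 2 + (d - a) * x * y + -c * y ^ 2) := by
  rcases lt_trichotomy b 0 with hb | rfl | hb
  · obtain ⟨x, y, h⟩ := exists_binaryForm_eq_one (-b) (a - d) c (by omega)
      (by linear_combination ht - 4 * hdet)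
      (by linear_combination 4 * hdet + sq_nonneg (a + d))
    exact ⟨x, y, Int.isUnit_iff.2 (Or.inr (by linear_combination -h))⟩
  · nlinarith [sq_nonneg (a - d)]
  · obtain ⟨x, y, h⟩ := exists_binaryForm_eq_one b (d - a) (-c) hb
      (by linear_combination ht - 4 * hdet)
      (by linear_combination 4 * hdet + sq_nonneg (a + d))
    exact ⟨x, y, Int.isUnit_iff.2 (Or.inl h)⟩

theorem IntegerConjugate.trace_eq {n : ℕ} {A B : Matrix (Fin n) (Fin n) ℤ}
    (h : IntegerConjugate A B) : A.trace = B.trace := by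
  obtain ⟨X, hX, h⟩ := h
  calc A.trace = (X⁻¹ * (X * A)).trace := by rw [← mul_assoc, nonsing_inv_mul X hX, one_mul]
    _ = (B * X * X⁻¹).trace := by rw [h, trace_mul_comm]
    _ = B.trace := by rw [mul_assoc, mul_nonsing_inv X hX, mul_one]

/-- A matrix of determinant one with `|trace| < 2` is integer conjugate to every matrix
`!![s, 1; -1, t]` with `s * t = 0` and the same trace. -/
theorem integerConjugate_of_trace_eq {M : Matrix (Fin 2) (Fin 2) ℤ} (hdet : M.det = 1)
    (ht : M.trace ^ 2 < 4) {s t : ℤ} (hst : s * t = 0) (htr : M.trace = s + t) :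
    IntegerConjugate M !![s, 1; -1, t] := by
  rw [det_fin_two] at hdet
  rw [trace_fin_two] at ht htr
  obtain ⟨x, y, hu⟩ := exists_isUnit_cyclic (M 0 0) (M 0 1) (M 1 0) (M 1 1) hdet ht
  refine ⟨!![x, y; M 0 0 * x + M 1 0 * y - s * x, M 0 1 * x + M 1 1 * y - s * y], ?_, ?_⟩
  · rw [det_fin_two_of]
    convert hu using 1
    ring
  · obtain rfl : t = M 0 0 + M 1 1 - s := by omega
    ext i j
    fin_cases i <;> fin_cases j <;> simp [mul_apply, Fin.sum_univ_two]
    · ring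
    · ring
    · linear_combination -x * hdet + x * hst
    · linear_combination -y * hdet + y * hst

theorem trace_sq_lt_four_of_no_real_root {M : Matrix (Fin 2) (Fin 2) ℤ} (hdet : M.det = 1)
    (h : ¬∃ x : ℝ, ((M.charpoly).map (Int.castRingHom ℝ)).IsRoot x) : M.trace ^ 2 < 4 := by
  contrapose! h
  have hnonneg : (0 : ℝ) ≤ (M.trace : ℝ) ^ 2 - 4 := by
    rw [sub_nonneg]
    exact_mod_cast h
  refine ⟨(M.trace + √((M.trace : ℝ) ^ 2 - 4)) / 2, ?_⟩
  rw [charpoly_fin_two, hdet]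
  simp only [IsRoot.def, Polynomial.map_add, Polynomial.map_sub, Polynomial.map_mul,
    Polynomial.map_pow, map_X, map_C, eval_add, eval_sub, eval_mul, eval_pow, eval_X, eval_C,
    Int.coe_castRingHom, Int.cast_one]
  linear_combination Real.sq_sqrt hnonneg / 4

/-- a matrix `M ∈ SL(2,ℤ)` whose characteristic polynomial has no real
roots is integer conjugate to exactly one of `[[1,1],[−1,0]]`, `[[0,1],[−1,0]]`,
`[[0,1],[−1,−1]]`, and these three are pairwise not integer conjugate. -/
theorem statement16 (M : Matrix (Fin 2) (Fin 2) ℤ) (hdet : M.det = 1)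
    (hnoreal : ¬∃ x : ℝ, ((M.charpoly).map (Int.castRingHom ℝ)).IsRoot x) :
    ((IntegerConjugate M !![1, 1; -1, 0] ∧ ¬IntegerConjugate M !![0, 1; -1, 0] ∧
        ¬IntegerConjugate M !![0, 1; -1, -1]) ∨
     (¬IntegerConjugate M !![1, 1; -1, 0] ∧ IntegerConjugate M !![0, 1; -1, 0] ∧
        ¬IntegerConjugate M !![0, 1; -1, -1]) ∨
     (¬IntegerConjugate M !![1, 1; -1, 0] ∧ ¬IntegerConjugate M !![0, 1; -1, 0] ∧
        IntegerConjugate M !![0, 1; -1, -1])) ∧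
    ¬IntegerConjugate (!![1, 1; -1, 0] : Matrix (Fin 2) (Fin 2) ℤ) !![0, 1; -1, 0] ∧
    ¬IntegerConjugate (!![1, 1; -1, 0] : Matrix (Fin 2) (Fin 2) ℤ) !![0, 1; -1, -1] ∧
    ¬IntegerConjugate (!![0, 1; -1, 0] : Matrix (Fin 2) (Fin 2) ℤ) !![0, 1; -1, -1] := by
  have ht := trace_sq_lt_four_of_no_real_root hdet hnoreal
  have hconj (s t : ℤ) (hst : s * t = 0) :
      IntegerConjugate M !![s, 1; -1, t] ↔ M.trace = s + t :=
    ⟨fun h => by simpa [trace_fin_two] using h.trace_eq,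
      integerConjugate_of_trace_eq hdet ht hst⟩
  rw [hconj 1 0 (by norm_num), hconj 0 0 (by norm_num), hconj 0 (-1) (by norm_num)]
  refine ⟨?_, fun h => ?_, fun h => ?_, fun h => ?_⟩
  · have hlt : M.trace < 2 := by nlinarith
    have hgt : -2 < M.trace := by nlinarith
    omega
  all_goals simpa [trace_fin_two] using h.trace_eq
end

section
/- Let a, b, c, d ∈ ℤ with 0 ≤ a < c and ad − bc = 1, and for m ∈ ℤ set H(m) = [[a, b + am],[c, d + cm]] (so H(m) ∈ SL(2,ℤ) for every m). Then for all but finitely many m ∈ ℤ: the characteristic polynomial of H(m) is irreducible over ℚ and has two distinct real roots, and H(m) is a reduced perfect Hessenberg matrix. -/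
open Matrix Polynomial

/-- Vieta descent: on the lattice `z ≡ -a y (mod c)`, with `a d ≡ 1` and `t ≡ a + d (mod c)`,
the form `y² + t y z + z²` is bounded below by `c²` away from the origin when `|t|` is large. -/
lemma sq_le_abs_form {c t : ℤ} (ht : 2 + 2 * c ^ 2 < |t|) (n : ℕ) :
    ∀ a d y z : ℤ, c ∣ a * d - 1 → c ∣ t - a - d → c ∣ z + a * y → ¬(y = 0 ∧ z = 0) →
      |y| + |z| ≤ n → c ^ 2 ≤ |y ^ 2 + t * y * z + z ^ 2| := by
  induction n with
  | zero =>
    intro a d y z _ _ _ hne hn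
    exfalso
    apply hne
    have h1 := abs_nonneg y
    have h2 := abs_nonneg z
    push_cast at hn
    exact ⟨abs_eq_zero.mp (by linarith), abs_eq_zero.mp (by linarith)⟩
  | succ n ih =>
    have key : ∀ a d y z : ℤ, c ∣ a * d - 1 → c ∣ t - a - d → c ∣ z + a * y →
        ¬(y = 0 ∧ z = 0) → |y| + |z| ≤ (n + 1 : ℕ) → |y| ≤ |z| →
        c ^ 2 ≤ |y ^ 2 + t * y * z + z ^ 2| := by
      intro a d y z had htad hz hne hn hyz
      by_cases hy : y = 0
      · subst hy
        have hz0 : z ≠ 0 := fun h => hne ⟨rfl, h⟩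
        have hcz : c ∣ z := by simpa using hz
        have h : |c| ≤ |z| := by
          have := Int.le_of_dvd (abs_pos.mpr hz0) ((abs_dvd_abs c z).mpr hcz)
          exact this
        have h' : c ^ 2 ≤ z ^ 2 := sq_le_sq.mpr h
        simpa using h'
      · by_contra! hlt
        have hy1 : 1 ≤ |y| := Int.one_le_abs hy
        by_cases hdesc : |-t * y - z| < |z|
        · have hdvd : c ∣ (-t * y - z) + d * y := by
            have : (-t * y - z) + d * y = -((t - a - d) * y + (z + a * y)) := by ring
            rw [this]
            exact (dvd_add (htad.mul_right _) hz).neg_right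
          have := ih d a y (-t * y - z) (by rwa [mul_comm])
            (by rwa [show t - d - a = t - a - d by ring]) hdvd (fun h => hy h.1)
            (by push_cast at hn; omega)
          rw [show y ^ 2 + t * y * (-t * y - z) + (-t * y - z) ^ 2
            = y ^ 2 + t * y * z + z ^ 2 by ring] at this
          linarith
        · push Not at hdesc
          set w := -t * y - z with hw
          have hprod : |z| * |w| ≤ |y| ^ 2 + c ^ 2 := by
            rw [← abs_mul, show z * w = y ^ 2 - (y ^ 2 + t * y * z + z ^ 2) by rw [hw]; ring]
            refine (abs_sub _ _).trans ?_
            rw [abs_pow]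
            linarith
          have hsum : |t| * |y| ≤ |z| + |w| := by
            rw [← abs_mul, ← abs_neg, show -(t * y) = z + w by rw [hw]; ring]
            exact abs_add_le _ _
          have hwle : |w| ≤ |y| + c ^ 2 := by
            by_contra! hgt
            nlinarith [sq_nonneg c, mul_le_mul_of_nonneg_right hyz (abs_nonneg w)]
          nlinarith [sq_nonneg c]
    intro a d y z had htad hz hne hn
    rcases le_total |y| |z| with h | h
    · exact key a d y z had htad hz hne hn h
    · have := key d a z y (by rwa [mul_comm])
        (by rwa [show t - d - a = t - a - d by ring])
        (by
          have : y + d * z = d * (z + a * y) - (a * d - 1) * y := by ring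
          rw [this]
          exact dvd_sub (hz.mul_left _) (had.mul_right _))
        (fun h => hne ⟨h.2, h.1⟩) (by linarith) h
      rwa [show z ^ 2 + t * z * y + y ^ 2 = y ^ 2 + t * y * z + z ^ 2 by ring] at this

lemma hessComplexity_fin_two (M : Matrix (Fin 2) (Fin 2) ℤ) : hessComplexity M = |M 1 0| := by
  simp [hessComplexity, subdiag]

lemma le_abs_of_integerConjugate {a B c D : ℤ} (hc : 0 < c) (hdet : a * D - B * c = 1)
    (ht : 2 + 2 * c ^ 2 < |a + D|) {M : Matrix (Fin 2) (Fin 2) ℤ}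
    (hM : IntegerConjugate !![a, B; c, D] M) : c ≤ |M 1 0| := by
  obtain ⟨X, hX, hXM⟩ := hM
  have h0 := congrFun (congrFun hXM 1) 0
  have h1 := congrFun (congrFun hXM 1) 1
  simp only [Matrix.mul_apply, Fin.sum_univ_two, Matrix.of_apply, Matrix.cons_val',
    Matrix.cons_val_zero, Matrix.cons_val_one, Matrix.cons_val_fin_one] at h0 h1
  rw [Matrix.det_fin_two] at hX
  have hform : c * (M 1 0 * (X 0 0 * X 1 1 - X 0 1 * X 1 0))
      = (-X 1 0) ^ 2 + (a + D) * (-X 1 0) * (c * X 1 1 + a * X 1 0)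
        + (c * X 1 1 + a * X 1 0) ^ 2 := by
    linear_combination (-c * X 1 1) * h0 + (c * X 1 0) * h1 + X 1 0 ^ 2 * hdet
  have hle := sq_le_abs_form ht (|-X 1 0| + |c * X 1 1 + a * X 1 0|).toNat a D (-X 1 0)
    (c * X 1 1 + a * X 1 0) ⟨B, by linarith⟩ ⟨0, by ring⟩ ⟨X 1 1, by ring⟩
    (by
      rintro ⟨h, h'⟩
      have hz : X 1 0 = 0 := by simpa using h
      have hz' : X 1 1 = 0 := by simpa [hz, hc.ne'] using h'
      simp [hz, hz'] at hX)
    (Int.self_le_toNat _)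
  rw [← hform, abs_mul, abs_mul, Int.isUnit_iff_abs_eq.mp hX, abs_of_pos hc] at hle
  nlinarith

lemma isRoot_map_charpoly_iff {K : Type*} [CommRing K] {M : Matrix (Fin 2) (Fin 2) ℤ}
    (hdet : M.det = 1) {x : K} :
    (M.charpoly.map (Int.castRingHom K)).IsRoot x ↔ x ^ 2 - M.trace * x + 1 = 0 := by
  rw [Matrix.charpoly_fin_two, hdet, map_one, Polynomial.IsRoot.def, Polynomial.eval_map]
  simp only [Polynomial.eval₂_add, Polynomial.eval₂_sub, Polynomial.eval₂_mul,
    Polynomial.eval₂_pow, Polynomial.eval₂_X, Polynomial.eval₂_one]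
  rw [Polynomial.eval₂_C, Int.coe_castRingHom]

lemma charpoly_irreducible_of_two_lt_abs_trace {M : Matrix (Fin 2) (Fin 2) ℤ} (hdet : M.det = 1)
    (ht : 2 < |M.trace|) : Irreducible (M.charpoly.map (Int.castRingHom ℚ)) := by
  have hmonic : (M.charpoly.map (Int.castRingHom ℚ)).Monic := M.charpoly_monic.map _
  have hdeg : (M.charpoly.map (Int.castRingHom ℚ)).natDegree = 2 := by
    rw [M.charpoly_monic.natDegree_map, Matrix.charpoly_natDegree_eq_dim, Fintype.card_fin]
  rw [hmonic.irreducible_iff_roots_eq_zero_of_degree_le_three hdeg.ge (by omega)]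
  refine Multiset.eq_zero_of_forall_notMem fun x hx => ?_
  have hx := (Polynomial.mem_roots'.mp hx).2
  rw [isRoot_map_charpoly_iff hdet] at hx
  have hsq : IsSquare ((M.trace ^ 2 - 4 : ℤ) : ℚ) :=
    ⟨2 * x - M.trace, by push_cast; linear_combination -4 * hx⟩
  obtain ⟨s, hs⟩ := Rat.isSquare_intCast_iff.mp hsq
  have hst : |s| * |s| = |M.trace| * |M.trace| - 4 := by
    rw [abs_mul_abs_self, abs_mul_abs_self]; linarith
  have h1 : |s| < |M.trace| := by nlinarith [abs_nonneg s]
  have h2 : |M.trace| - 1 < |s| := by nlinarith [abs_nonneg s]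
  omega

lemma exists_distinct_real_roots_charpoly {M : Matrix (Fin 2) (Fin 2) ℤ} (hdet : M.det = 1)
    (ht : 2 < |M.trace|) : ∃ x y : ℝ, x ≠ y ∧
      (M.charpoly.map (Int.castRingHom ℝ)).IsRoot x ∧
      (M.charpoly.map (Int.castRingHom ℝ)).IsRoot y := by
  have hpos : (0 : ℝ) < (M.trace : ℝ) ^ 2 - 4 := by
    have h : 0 < M.trace ^ 2 - 4 := by nlinarith [sq_abs M.trace]
    exact_mod_cast h
  have hsq := Real.sq_sqrt hpos.le
  have hsqrt := Real.sqrt_pos.mpr hpos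
  refine ⟨(M.trace + √((M.trace : ℝ) ^ 2 - 4)) / 2, (M.trace - √((M.trace : ℝ) ^ 2 - 4)) / 2,
    fun h => by linarith, ?_, ?_⟩ <;>
  · rw [isRoot_map_charpoly_iff hdet]
    linear_combination hsq / 4

/-- for `0 ≤ a < c`, `ad − bc = 1` and `H(m) = [[a, b+am],[c, d+cm]]`
(a one-parameter family in `SL(2,ℤ)` of fixed Hessenberg type), for all but finitely
many `m ∈ ℤ` the characteristic polynomial of `H(m)` is irreducible over ℚ with two
distinct real roots and `H(m)` is a reduced perfect Hessenberg matrix. -/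
theorem statement17 (a b c d : ℤ) (ha : 0 ≤ a) (hac : a < c) (hdet : a * d - b * c = 1) :
    {m : ℤ | ¬(Irreducible
        (((!![a, b + a * m; c, d + c * m] : Matrix (Fin 2) (Fin 2) ℤ).charpoly).map
          (Int.castRingHom ℚ)) ∧
      (∃ x y : ℝ, x ≠ y ∧
        ((!![a, b + a * m; c, d + c * m] : Matrix (Fin 2) (Fin 2) ℤ).charpoly.map
          (Int.castRingHom ℝ)).IsRoot x ∧
        ((!![a, b + a * m; c, d + c * m] : Matrix (Fin 2) (Fin 2) ℤ).charpoly.map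
          (Int.castRingHom ℝ)).IsRoot y) ∧
      IsReducedHess (!![a, b + a * m; c, d + c * m] : Matrix (Fin 2) (Fin 2) ℤ))}.Finite := by
  have hc : 0 < c := by omega
  refine (Set.finite_Icc (-(2 + 2 * c ^ 2 + |a + d|)) (2 + 2 * c ^ 2 + |a + d|)).subset ?_
  intro m hm
  suffices h : |m| ≤ 2 + 2 * c ^ 2 + |a + d| from abs_le.mp h
  by_contra! hlt
  refine hm ?_
  have ht : 2 + 2 * c ^ 2 < |a + (d + c * m)| := by
    have h1 : |c * m| ≤ |a + (d + c * m)| + |a + d| := by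
      have h2 := abs_sub (a + (d + c * m)) (a + d)
      rwa [show a + (d + c * m) - (a + d) = c * m by ring] at h2
    rw [abs_mul, abs_of_pos hc] at h1
    nlinarith [abs_nonneg m]
  have hdet' : a * (d + c * m) - (b + a * m) * c = 1 := by linear_combination hdet
  have hdetM : (!![a, b + a * m; c, d + c * m] : Matrix (Fin 2) (Fin 2) ℤ).det = 1 := by
    rw [Matrix.det_fin_two_of]; exact hdet'
  have htr : 2 < |(!![a, b + a * m; c, d + c * m] : Matrix (Fin 2) (Fin 2) ℤ).trace| := by
    rw [Matrix.trace_fin_two_of]; nlinarith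
  have hirr := charpoly_irreducible_of_two_lt_abs_trace hdetM htr
  refine ⟨hirr, exists_distinct_real_roots_charpoly hdetM htr, ⟨hdetM, ?_, hirr, ?_⟩, ?_⟩
  · intro i j hij
    omega
  · intro i j hij hj
    obtain rfl : j = 0 := by omega
    obtain rfl : i = 0 := by omega
    simpa [subdiag] using And.intro ha hac
  · intro M _ hconj
    rw [hessComplexity_fin_two, hessComplexity_fin_two]
    simpa [abs_of_pos hc] using le_abs_of_integerConjugate hc hdet' ht hconj
end

section
/- The matrices A = [[0,1,3],[1,0,0],[0,3,8]] and B = [[0,2,5],[1,1,2],[0,3,7]] both lie in SL(3,ℤ), have equal characteristic polynomials (namely t³ − 8t² − t − 1) and equal Hessenberg complexity 3, but they are not integer conjugate: there is no X ∈ GL(3,ℤ) with X A X⁻¹ = B. -/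
open Matrix Polynomial

/-- If `A` squares to the identity modulo `m`, so does every integer conjugate of `A`. -/
theorem IntegerConjugate.exists_sq_sub_one_eq_smul {n : ℕ} {A B C : Matrix (Fin n) (Fin n) ℤ}
    {m : ℤ} (h : IntegerConjugate A B) (hA : A * A - 1 = m • C) :
    ∃ D : Matrix (Fin n) (Fin n) ℤ, B * B - 1 = m • D := by
  obtain ⟨X, hX, hXA⟩ := h
  refine ⟨X * C * X⁻¹, ?_⟩
  have key : (B * B - 1) * X = m • (X * C) := by
    rw [← Matrix.mul_smul, ← hA, Matrix.sub_mul, Matrix.mul_sub, Matrix.mul_assoc, ← hXA,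
      ← Matrix.mul_assoc, ← hXA, Matrix.mul_assoc, Matrix.one_mul, Matrix.mul_one]
  rw [← Matrix.smul_mul, ← key, Matrix.mul_nonsing_inv_cancel_right _ _ hX]

/-- the matrices `A = [[0,1,3],[1,0,0],[0,3,8]]` and
`B = [[0,2,5],[1,1,2],[0,3,7]]` lie in `SL(3,ℤ)`, have the same characteristic
polynomial `t³ − 8t² − t − 1` and the same Hessenberg complexity 3, but are not
integer conjugate. -/
theorem statement18 :
    (!![0, 1, 3; 1, 0, 0; 0, 3, 8] : Matrix (Fin 3) (Fin 3) ℤ).det = 1 ∧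
    (!![0, 2, 5; 1, 1, 2; 0, 3, 7] : Matrix (Fin 3) (Fin 3) ℤ).det = 1 ∧
    (!![0, 1, 3; 1, 0, 0; 0, 3, 8] : Matrix (Fin 3) (Fin 3) ℤ).charpoly =
      X ^ 3 - C 8 * X ^ 2 - C 1 * X - C 1 ∧
    (!![0, 2, 5; 1, 1, 2; 0, 3, 7] : Matrix (Fin 3) (Fin 3) ℤ).charpoly =
      (!![0, 1, 3; 1, 0, 0; 0, 3, 8] : Matrix (Fin 3) (Fin 3) ℤ).charpoly ∧
    hessComplexity (!![0, 1, 3; 1, 0, 0; 0, 3, 8] : Matrix (Fin 3) (Fin 3) ℤ) = 3 ∧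
    hessComplexity (!![0, 2, 5; 1, 1, 2; 0, 3, 7] : Matrix (Fin 3) (Fin 3) ℤ) = 3 ∧
    ¬IntegerConjugate (!![0, 1, 3; 1, 0, 0; 0, 3, 8] : Matrix (Fin 3) (Fin 3) ℤ)
      !![0, 2, 5; 1, 1, 2; 0, 3, 7] := by
  refine ⟨by decide, by decide, ?_, ?_, ?_, ?_, fun h => ?_⟩
  · simp [Matrix.charpoly, Matrix.charmatrix, Matrix.det_fin_three]
    ring
  · simp [Matrix.charpoly, Matrix.charmatrix, Matrix.det_fin_three]
    ring
  · decide
  · decide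
  · obtain ⟨D, hD⟩ := h.exists_sq_sub_one_eq_smul (m := 3)
      (C := !![0, 3, 8; 0, 0, 1; 1, 8, 21]) (by decide)
    have h00 := congrFun (congrFun hD 0) 0
    simp at h00
    omega
end
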